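/- arXiv:math/0611055 — 3 statements merged into one kernel-verified Lean document; each statement's English description precedes it below -/
import Mathlib

section
/- Let (W, I) be a Coxeter group and δ: W → W an automorphism with δ(I) = I, such that all standard parabolic subgroups W_J for proper δ-stable subsets J of I are finite. Then for every x ∈ W, the element x δ(x)⁻¹ can be reduced to the identity element by a sequence of δ-twisted conjugations by simple reflections with weakly decreasing lengths (i.e., x δ(x)⁻¹ →_δ 1). -/
open CoxeterSystem

variable {B W : Type*} [Group W] {M : CoxeterMatrix B}

/-- One step of δ-twisted conjugation by a simple reflection, with weakly decreasing length:
`w →^{s_i}_δ w'` iff `w' = s_i w δ(s_i)` and `ℓ(w') ≤ ℓ(w)`. -/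
def TwistedStep (cs : CoxeterSystem M W) (δ : W ≃* W) (w w' : W) : Prop :=
  ∃ i : B, w' = cs.simple i * w * δ (cs.simple i) ∧ cs.length w' ≤ cs.length w

namespace TwCob

/-- simple root -/
noncomputable def al (i : B) : B →₀ ℝ := Finsupp.single i 1

/-- `i`-th simple coroot functional -/
noncomputable def Bf (M : CoxeterMatrix B) (i : B) : (B →₀ ℝ) →ₗ[ℝ] ℝ :=
  Finsupp.linearCombination ℝ (fun j => -2 * Real.cos (Real.pi / (M i j : ℝ)))

lemma Bf_al (i j : B) : Bf M i (al j) = -2 * Real.cos (Real.pi / (M i j : ℝ)) := by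
  simp [Bf, al]

lemma Bf_self (i : B) : Bf M i (al i) = 2 := by
  simp [Bf_al]

/-- simple reflection in the geometric representation -/
noncomputable def sg (M : CoxeterMatrix B) (i : B) : Module.End ℝ (B →₀ ℝ) :=
  LinearMap.id - (Bf M i).smulRight (al i)

lemma sg_apply (i : B) (v : B →₀ ℝ) : sg M i v = v - (Bf M i v) • al i := by
  simp [sg]

lemma sg_sq (i : B) : sg M i * sg M i = 1 := by
  ext1 v
  apply LinearMap.ext
  intro c
  simp only [LinearMap.comp_apply, Module.End.mul_apply, sg_apply, map_sub, map_smul, Bf_self,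
    smul_eq_mul, Module.End.one_apply]
  module

/-- Chebyshev-type sequence -/
noncomputable def U (c : ℝ) : ℕ → ℝ
  | 0 => 0
  | 1 => 1
  | (n + 2) => 2 * c * U c (n + 1) - U c n

lemma sin_mul_U (t : ℝ) (n : ℕ) :
    Real.sin t * U (Real.cos t) n = Real.sin (n * t) ∧
    Real.sin t * U (Real.cos t) (n + 1) = Real.sin ((n + 1 : ℕ) * t) := by
  induction n with
  | zero => simp [U]
  | succ n ih =>
    refine ⟨ih.2, ?_⟩
    have h1 := ih.1
    have h2 := ih.2
    have e : Real.sin ((n + 1 + 1 : ℕ) * t) + Real.sin (n * t)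
        = 2 * Real.cos t * Real.sin ((n + 1 : ℕ) * t) := by
      have a1 : ((n + 1 + 1 : ℕ) : ℝ) * t = (n + 1 : ℕ) * t + t := by push_cast; ring
      have a2 : (n : ℝ) * t = (n + 1 : ℕ) * t - t := by push_cast; ring
      rw [a1, a2, Real.sin_add, Real.sin_sub]; ring
    show Real.sin t * (2 * Real.cos t * U (Real.cos t) (n + 1) - U (Real.cos t) n) = _
    linear_combination 2 * Real.cos t * h2 - h1 - e

lemma U_one (n : ℕ) : U 1 n = n ∧ U 1 (n + 1) = n + 1 := by
  induction n with
  | zero => simp [U]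
  | succ n ih =>
    refine ⟨by rw [ih.2]; push_cast; ring, ?_⟩
    show 2 * 1 * U 1 (n + 1) - U 1 n = _
    rw [ih.1, ih.2]; push_cast; ring

lemma sin_pos_m {m : ℕ} (hm : 2 ≤ m) : 0 < Real.sin (Real.pi / m) := by
  have hm' : (2 : ℝ) ≤ m := by exact_mod_cast hm
  apply Real.sin_pos_of_pos_of_lt_pi
  · have := Real.pi_pos; positivity
  · rw [div_lt_iff₀ (by linarith)]
    nlinarith [Real.pi_pos]

lemma U_nonneg {m : ℕ} (hm : m ≠ 1) (k : ℕ) (hk : m = 0 ∨ k ≤ m) :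
    0 ≤ U (Real.cos (Real.pi / m)) k := by
  rcases Nat.eq_zero_or_pos m with h0 | h0
  · subst h0
    simp [(U_one k).1]
  · have hs := sin_pos_m (m := m) (by omega)
    have hk' : (k : ℝ) ≤ m := by exact_mod_cast (by omega : k ≤ m)
    have hmp : (0 : ℝ) < m := by exact_mod_cast h0
    have := (sin_mul_U (Real.pi / m) k).1
    have h2 : 0 ≤ Real.sin (k * (Real.pi / m)) := by
      apply Real.sin_nonneg_of_nonneg_of_le_pi
      · have := Real.pi_pos; positivity
      · rw [← mul_div_assoc, div_le_iff₀ hmp]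
        nlinarith [Real.pi_pos]
    rw [← this] at h2
    exact nonneg_of_mul_nonneg_right h2 hs

lemma U_two_m {m : ℕ} (hm : 2 ≤ m) : U (Real.cos (Real.pi / m)) (2 * m) = 0 ∧
    U (Real.cos (Real.pi / m)) (2 * m + 1) = 1 := by
  have hs := sin_pos_m hm
  have hmp : (m : ℝ) ≠ 0 := by positivity
  have h := sin_mul_U (Real.pi / m) (2 * m)
  have e1 : ((2 * m : ℕ) : ℝ) * (Real.pi / m) = 2 * Real.pi := by push_cast; field_simp
  have e2 : ((2 * m + 1 : ℕ) : ℝ) * (Real.pi / m) = Real.pi / m + 2 * Real.pi := by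
    push_cast; field_simp; ring
  rw [e1, e2, Real.sin_two_pi, Real.sin_add_two_pi] at h
  constructor
  · rcases mul_eq_zero.1 h.1 with h' | h'
    · linarith
    · exact h'
  · exact mul_left_cancel₀ hs.ne' (by rw [h.2, mul_one])

lemma sg_al_comb (i j : B) (x y : ℝ) :
    sg M i (x • al i + y • al j) =
      (2 * Real.cos (Real.pi / (M i j : ℝ)) * y - x) • al i + y • al j := by
  simp only [sg_apply, map_add, map_smul, Bf_self, Bf_al, smul_eq_mul]
  module

lemma sg_pow_al_left (i j : B) (k : ℕ) :
    ((sg M i * sg M j) ^ k) (al i) =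
      U (Real.cos (Real.pi / (M i j : ℝ))) (2 * k + 1) • al i +
      U (Real.cos (Real.pi / (M i j : ℝ))) (2 * k) • al j := by
  induction k with
  | zero => simp [U]
  | succ k ih =>
    rw [pow_succ', Module.End.mul_apply, ih, Module.End.mul_apply, add_comm, sg_al_comb,
      add_comm, M.symmetric j i, sg_al_comb]
    rfl

lemma sg_pow_al_right (i j : B) (k : ℕ) :
    ((sg M i * sg M j) ^ k) (sg M i (al j)) =
      U (Real.cos (Real.pi / (M i j : ℝ))) (2 * k + 2) • al i +
      U (Real.cos (Real.pi / (M i j : ℝ))) (2 * k + 1) • al j := by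
  induction k with
  | zero =>
    have := sg_al_comb (M := M) i j 0 1
    simp only [zero_smul, zero_add, one_smul] at this
    simp [U, this]
  | succ k ih =>
    rw [pow_succ', Module.End.mul_apply, ih, Module.End.mul_apply, add_comm, sg_al_comb,
      add_comm, M.symmetric j i, sg_al_comb]
    rfl

lemma sg_liftable : M.IsLiftable (sg M) := by
  intro i j
  by_cases hij : i = j
  · subst hij; simp [sg_sq]
  rcases Nat.eq_zero_or_pos (M i j) with h0 | h0
  · simp [h0]
  have hm : 2 ≤ M i j := by
    have := M.off_diagonal i j hij
    omega
  set c := Real.cos (Real.pi / (M i j : ℝ)) with hc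
  have hs := sin_pos_m hm
  have hU := U_two_m hm
  rw [← hc] at hU
  have hl : ((sg M i * sg M j) ^ (M i j)) (al i) = al i := by
    rw [sg_pow_al_left, ← hc, hU.1, hU.2]; simp
  have hr' : ((sg M i * sg M j) ^ (M i j)) (sg M i (al j)) = sg M i (al j) := by
    rw [sg_pow_al_right, ← hc]
    have : U c (2 * M i j + 2) = 2 * c := by
      show 2 * c * U c (2 * M i j + 1) - U c (2 * M i j) = _
      rw [hU.1, hU.2]; ring
    rw [this, hU.2]
    have := sg_al_comb (M := M) i j 0 1
    simp only [zero_smul, zero_add, one_smul] at this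
    rw [this]; simp [hc]
  have hr : ((sg M i * sg M j) ^ (M i j)) (al j) = al j := by
    have e : al j = sg M i (al j) + (Bf M i (al j)) • al i := by rw [sg_apply]; module
    rw [e, map_add, map_smul, hr', hl]
  have hd : 1 - c ^ 2 ≠ 0 := by
    have := Real.sin_sq_add_cos_sq (Real.pi / (M i j : ℝ))
    rw [← hc] at this
    have h2 : 0 < Real.sin (Real.pi / (M i j : ℝ)) ^ 2 := by positivity
    intro h; nlinarith
  apply LinearMap.ext
  intro v
  set a := Bf M i v
  set b := Bf M j v
  let x := (a + c * b) / (2 * (1 - c ^ 2))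
  let y := (b + c * a) / (2 * (1 - c ^ 2))
  obtain ⟨u, hu⟩ : ∃ u, u = v - x • al i - y • al j := ⟨_, rfl⟩
  have hui : Bf M i u = 0 := by
    rw [hu]; simp only [map_sub, map_smul, Bf_self, Bf_al, smul_eq_mul, ← hc]
    show a - x * 2 - y * (-2 * c) = 0
    simp only [x, y]; field_simp; ring
  have huj : Bf M j u = 0 := by
    rw [hu]; simp only [map_sub, map_smul, Bf_self, Bf_al, smul_eq_mul, M.symmetric j i, ← hc]
    show b - x * (-2 * c) - y * 2 = 0
    simp only [x, y]; field_simp; ring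
  have hfix : ∀ k : ℕ, ((sg M i * sg M j) ^ k) u = u := by
    intro k
    induction k with
    | zero => simp
    | succ k ih =>
      rw [pow_succ', Module.End.mul_apply, ih, Module.End.mul_apply]
      simp [sg_apply, hui, huj]
  have hv : v = u + x • al i + y • al j := by rw [hu]; module
  rw [Module.End.one_apply, hv, map_add, map_add, map_smul, map_smul, hl, hr, hfix]

/-- geometric representation -/
noncomputable def rh (cs : CoxeterSystem M W) : W →* Module.End ℝ (B →₀ ℝ) :=
  cs.lift ⟨sg M, sg_liftable⟩

lemma rh_simple (cs : CoxeterSystem M W) (i : B) : rh cs (cs.simple i) = sg M i :=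
  cs.lift_apply_simple _ i

lemma rh_inv_apply (cs : CoxeterSystem M W) (w : W) (v : B →₀ ℝ) :
    rh cs w⁻¹ (rh cs w v) = v := by
  rw [← Module.End.mul_apply, ← map_mul]; simp

lemma rh_apply_inv (cs : CoxeterSystem M W) (w : W) (v : B →₀ ℝ) :
    rh cs w (rh cs w⁻¹ v) = v := by
  rw [← Module.End.mul_apply, ← map_mul]; simp

lemma rh_mul (cs : CoxeterSystem M W) (w u : W) (v : B →₀ ℝ) :
    rh cs (w * u) v = rh cs w (rh cs u v) := by
  rw [map_mul, Module.End.mul_apply]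

/-- nonnegative vectors -/
def Pos (v : B →₀ ℝ) : Prop := ∀ j, 0 ≤ v j

lemma Pos.comb {u v : B →₀ ℝ} (hu : Pos u) (hv : Pos v) {x y : ℝ} (hx : 0 ≤ x) (hy : 0 ≤ y) :
    Pos (x • u + y • v) := by
  intro j
  have := hu j
  have := hv j
  simp only [Finsupp.add_apply, Finsupp.smul_apply, smul_eq_mul]
  positivity

lemma pos_al (i : B) : Pos (al i) := by
  intro j
  classical
  simp only [al, Finsupp.single_apply]
  split_ifs <;> norm_num

lemma al_ne (i : B) : al i ≠ 0 := by simp [al]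

lemma orderOf_simple_mul (cs : CoxeterSystem M W) (i j : B) :
    orderOf (cs.simple i * cs.simple j) = M i j := by
  apply Nat.dvd_antisymm
  · exact orderOf_dvd_of_pow_eq_one (cs.simple_mul_simple_pow i j)
  by_cases hij : i = j
  · subst hij; simp
  obtain ⟨k, hk⟩ : ∃ k, k = orderOf (cs.simple i * cs.simple j) := ⟨_, rfl⟩
  rw [← hk]
  have h1 : (cs.simple i * cs.simple j) ^ k = 1 := by rw [hk]; exact pow_orderOf_eq_one _
  have h2 := congrArg (fun w => rh cs w (al i)) h1
  simp only [map_pow, map_mul, rh_simple, map_one, Module.End.one_apply] at h2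
  rw [sg_pow_al_left] at h2
  have hi := DFunLike.congr_fun h2 i
  have hj := DFunLike.congr_fun h2 j
  simp only [al, Finsupp.add_apply, Finsupp.smul_apply, Finsupp.single_eq_same,
    Finsupp.single_eq_of_ne hij, Finsupp.single_eq_of_ne (Ne.symm hij), smul_eq_mul, mul_one,
    mul_zero, add_zero, zero_add] at hi hj
  rcases Nat.eq_zero_or_pos (M i j) with h0 | h0
  · rw [h0] at hj ⊢
    simp only [Nat.cast_zero, div_zero, Real.cos_zero, (U_one _).1] at hj
    have : 2 * k = 0 := by exact_mod_cast hj
    have : k = 0 := by omega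
    simp [this]
  · have hm : 2 ≤ M i j := by
      have := M.off_diagonal i j hij
      omega
    have hs := sin_pos_m hm
    have h := sin_mul_U (Real.pi / M i j) (2 * k)
    rw [hi, hj] at h
    have e2 : ((2 * k + 1 : ℕ) : ℝ) * (Real.pi / M i j) =
      (2 * k : ℕ) * (Real.pi / M i j) + Real.pi / M i j := by push_cast; ring
    rw [e2, Real.sin_add, ← h.1] at h
    have hc : Real.cos ((2 * k : ℕ) * (Real.pi / M i j)) = 1 := by
      apply mul_right_cancel₀ hs.ne'
      linarith [h.2]
    rw [Real.cos_eq_one_iff] at hc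
    obtain ⟨n, hn⟩ := hc
    have hmp : (M i j : ℝ) ≠ 0 := by positivity
    have : (k : ℝ) = M i j * n := by
      have hpi := Real.pi_ne_zero
      push_cast at hn
      field_simp at hn
      linarith
    have : (k : ℤ) = M i j * n := by exact_mod_cast this
    exact Int.natCast_dvd_natCast.1 ⟨n, this⟩

/-- action of the alternating words -/
lemma rh_alt (cs : CoxeterSystem M W) (i j : B) (k : ℕ) :
    rh cs (cs.wordProd (alternatingWord i j k)) (al i) =
      U (Real.cos (Real.pi / (M i j : ℝ))) (k + 1) • al (if Even k then i else j) +
      U (Real.cos (Real.pi / (M i j : ℝ))) k • al (if Even k then j else i) := by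
  induction k with
  | zero => simp [U, alternatingWord]
  | succ k ih =>
    rw [alternatingWord_succ', cs.wordProd_cons, rh_mul, ih, rh_simple]
    by_cases hk : Even k
    · have hk' : ¬ Even (k + 1) := by simpa [Nat.even_add_one] using hk
      simp only [hk, hk', if_true, if_false]
      rw [add_comm, sg_al_comb, M.symmetric j i]
      rfl
    · have hk' : Even (k + 1) := by simpa [Nat.even_add_one] using hk
      simp only [hk, hk', if_true, if_false]
      rw [add_comm, sg_al_comb]
      rfl

theorem pos_of_not_descent (cs : CoxeterSystem M W) (n : ℕ) : ∀ (w : W) (i : B),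
    cs.length w = n → ¬ cs.IsRightDescent w i → Pos (rh cs w (al i)) := by
  induction n using Nat.strong_induction_on with
  | _ n IH =>
  intro w i hn hd
  by_cases hw : w = 1
  · subst hw; simpa using pos_al i
  obtain ⟨j, hj⟩ := cs.exists_rightDescent_of_ne_one hw
  have hij : i ≠ j := by rintro rfl; exact hd hj
  have hm1 : M i j ≠ 1 := M.off_diagonal i j hij
  let a : ℕ → W := fun k => cs.wordProd (alternatingWord i j k)
  have ha : ∀ k, a (k + 1) = cs.simple (if Even k then j else i) * a k := by
    intro k; simp only [a]; rw [alternatingWord_succ', cs.wordProd_cons]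
  have hla : ∀ k, cs.length (a k) ≤ k := by
    intro k
    have := cs.length_wordProd_le (alternatingWord i j k)
    rwa [length_alternatingWord] at this
  let P : ℕ → Prop := fun k => cs.length (w * (a k)⁻¹) + k = cs.length w
  have hP1 : P 1 := by
    have : a 1 = cs.simple j := by simp [a, alternatingWord]
    simp only [P, this, cs.inv_simple]
    exact cs.isRightDescent_iff.1 hj
  have hbd : ∀ k, P k → k ≤ cs.length w := by
    intro k hk; simp only [P] at hk; omega
  classical
  let k := Nat.findGreatest P (cs.length w)
  have hk1 : 1 ≤ k := Nat.le_findGreatest (hbd 1 hP1) hP1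
  have hPk : P k := Nat.findGreatest_spec (hbd 1 hP1) hP1
  have hPk1 : ¬ P (k + 1) := fun h => by
    have := Nat.le_findGreatest (hbd _ h) h
    change k + 1 ≤ k at this
    omega
  obtain ⟨u, hu⟩ : ∃ u, u = w * (a k)⁻¹ := ⟨_, rfl⟩
  have hlu : cs.length u + k = cs.length w := by rw [hu]; exact hPk
  have hwu : w = u * a k := by rw [hu]; group
  -- next letter
  have hx : ¬ cs.IsRightDescent u (if Even k then j else i) := by
    intro h
    apply hPk1
    have h' := cs.isRightDescent_iff.1 h
    simp only [P]
    rw [ha, mul_inv_rev, cs.inv_simple, ← mul_assoc, ← hu]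
    omega
  have hx' : ¬ cs.IsRightDescent u (if Even k then i else j) := by
    intro h
    have h' := cs.isRightDescent_iff.1 h
    obtain ⟨l, hl⟩ : ∃ l, k = l + 1 := ⟨k - 1, by omega⟩
    have e : (if Even k then i else j) = (if Even l then j else i) := by
      rw [hl]; by_cases hh : Even l <;> simp [Nat.even_add_one, hh]
    rw [e] at h'
    have : w = (u * cs.simple (if Even l then j else i)) * a l := by
      rw [hwu, hl, ha, mul_assoc]
    have h3 := cs.length_mul_le (u * cs.simple (if Even l then j else i)) (a l)
    rw [← this] at h3
    have := hla l
    omega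
  have hkm : M i j = 0 ∨ k + 1 ≤ M i j := by
    by_contra hcon
    push Not at hcon
    obtain ⟨h0, hlt⟩ := hcon
    have hmk : M i j ≤ k := by omega
    -- split a k
    obtain ⟨d, hd'⟩ : ∃ d, k = M i j + d := ⟨k - M i j, by omega⟩
    have hsplit : ∀ d, ∃ b : W, a (M i j + d) = b * a (M i j) ∧ cs.length b ≤ d := by
      intro d
      induction d with
      | zero => exact ⟨1, by simp, by simp⟩
      | succ d ih =>
        obtain ⟨b, hb, hb'⟩ := ih
        refine ⟨cs.simple (if Even (M i j + d) then j else i) * b, ?_, ?_⟩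
        · rw [← add_assoc, ha, hb, mul_assoc]
        · have := cs.length_mul_le (cs.simple (if Even (M i j + d) then j else i)) b
          rw [cs.length_simple] at this
          omega
    obtain ⟨b, hb, hb'⟩ := hsplit d
    have hbr : a (M i j) = cs.wordProd (alternatingWord j i (M i j)) := by
      have := cs.wordProd_braidWord_eq i j
      simp only [braidWord] at this
      rw [M.symmetric j i] at this
      exact this
    obtain ⟨m, hm⟩ : ∃ m, M i j = m + 1 := ⟨M i j - 1, by omega⟩
    have : w * cs.simple i = u * b * cs.wordProd (alternatingWord i j m) := by
      rw [hwu, hd', hb, hbr, hm, alternatingWord_succ, cs.wordProd_concat]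
      simp [mul_assoc]
    have h1 := cs.length_mul_le (u * b) (cs.wordProd (alternatingWord i j m))
    have h2 := cs.length_mul_le u b
    have h3 := hla m
    simp only [a] at h3
    rw [← this] at h1
    apply hd
    show cs.length (w * cs.simple i) < cs.length w
    omega
  have hlt : cs.length u < n := by omega
  have p1 := IH _ hlt u _ rfl hx
  have p2 := IH _ hlt u _ rfl hx'
  rw [hwu, rh_mul]
  show Pos (rh cs u (rh cs (cs.wordProd (alternatingWord i j k)) (al i)))
  rw [rh_alt, map_add, map_smul, map_smul]
  exact p2.comb p1 (U_nonneg hm1 _ hkm) (U_nonneg hm1 _ (by omega))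

lemma rh_simple_self (cs : CoxeterSystem M W) (i : B) : rh cs (cs.simple i) (al i) = - al i := by
  rw [rh_simple, sg_apply, Bf_self]; module

lemma neg_of_descent (cs : CoxeterSystem M W) (w : W) (i : B) (h : cs.IsRightDescent w i) :
    Pos (-(rh cs w (al i))) := by
  have := pos_of_not_descent cs _ (w * cs.simple i) i rfl
    (cs.isRightDescent_iff_not_isRightDescent_mul.1 h)
  rwa [rh_mul, rh_simple_self, map_neg] at this

lemma rh_ne (cs : CoxeterSystem M W) (w : W) (i : B) : rh cs w (al i) ≠ 0 := by
  intro h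
  have := rh_inv_apply cs w (al i)
  rw [h, map_zero] at this
  exact al_ne i this.symm

lemma pos_or_neg (cs : CoxeterSystem M W) (w : W) (i : B) :
    Pos (rh cs w (al i)) ∨ Pos (-(rh cs w (al i))) := by
  by_cases h : cs.IsRightDescent w i
  · exact Or.inr (neg_of_descent cs w i h)
  · exact Or.inl (pos_of_not_descent cs _ w i rfl h)

lemma eq_zero_of_pos_neg {v : B →₀ ℝ} (h : Pos v) (h' : Pos (-v)) : v = 0 := by
  ext j
  have := h j
  have := h' j
  simp only [Finsupp.neg_apply] at this
  simp only [Finsupp.zero_apply]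
  linarith

lemma descent_of_neg (cs : CoxeterSystem M W) (w : W) (i : B) (h : Pos (-(rh cs w (al i)))) :
    cs.IsRightDescent w i := by
  by_contra h'
  exact rh_ne cs w i (eq_zero_of_pos_neg (pos_of_not_descent cs _ w i rfl h') h)

lemma simple_inj (cs : CoxeterSystem M W) : Function.Injective cs.simple := by
  intro i j hij
  by_contra hne
  have h1 := rh_simple_self cs i
  rw [hij, rh_simple, sg_apply] at h1
  have := DFunLike.congr_fun h1 i
  simp [al, Finsupp.single_eq_of_ne hne] at this
  norm_num at this

end TwCob

namespace TwCob

/-- action of the diagram permutation on the root space -/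
noncomputable def Pv (p : B ≃ B) : (B →₀ ℝ) ≃ₗ[ℝ] (B →₀ ℝ) := Finsupp.domLCongr p

lemma Pv_al (p : B ≃ B) (i : B) : Pv p (al i) = al (p i) := by simp [Pv, al]

lemma Pv_apply (p : B ≃ B) (v : B →₀ ℝ) (j : B) : Pv p v (p j) = v j := by
  simp [Pv, Finsupp.domLCongr_apply]

lemma M_inv (cs : CoxeterSystem M W) (δ : W ≃* W) (p : B ≃ B)
    (hδ : ∀ i : B, δ (cs.simple i) = cs.simple (p i)) (i j : B) : M (p i) (p j) = M i j := by
  rw [← orderOf_simple_mul cs, ← orderOf_simple_mul cs i j, ← hδ, ← hδ, ← map_mul]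
  exact MulEquiv.orderOf_eq δ _

lemma Bf_Pv (p : B ≃ B) (hM : ∀ i j, M (p i) (p j) = M i j) (i : B) (v : B →₀ ℝ) :
    Bf M (p i) (Pv p v) = Bf M i v := by
  have : (Bf M (p i)) ∘ₗ (Pv p).toLinearMap = Bf M i := by
    apply Finsupp.lhom_ext'
    intro j
    apply LinearMap.ext_ring
    have := Pv_al p j
    have h2 := Bf_al (M := M) (p i) (p j)
    have h3 := Bf_al (M := M) i j
    rw [hM] at h2
    show Bf M (p i) (Pv p (al j)) = Bf M i (al j)
    rw [this, h2, h3]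
  exact LinearMap.congr_fun this v

lemma Pv_rh (cs : CoxeterSystem M W) (δ : W ≃* W) (p : B ≃ B)
    (hδ : ∀ i : B, δ (cs.simple i) = cs.simple (p i)) (w : W) :
    ∀ v, Pv p (rh cs w v) = rh cs (δ w) (Pv p v) := by
  induction w using cs.simple_induction_left with
  | one => simp
  | mul_simple_left w i ih =>
    intro v
    rw [map_mul δ, hδ, rh_mul, rh_mul, rh_simple, rh_simple, sg_apply, sg_apply, ← ih,
      Bf_Pv p (M_inv cs δ p hδ), map_sub, map_smul, Pv_al]

lemma step_of_length (cs : CoxeterSystem M W) (δ : W ≃* W) (y : W) (i : B)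
    (h : cs.length (cs.simple i * (y⁻¹ * δ y) * δ (cs.simple i)) ≤ cs.length (y⁻¹ * δ y)) :
    TwistedStep cs δ (y⁻¹ * δ y) ((y * cs.simple i)⁻¹ * δ (y * cs.simple i)) := by
  have e : (y * cs.simple i)⁻¹ * δ (y * cs.simple i)
      = cs.simple i * (y⁻¹ * δ y) * δ (cs.simple i) := by
    rw [mul_inv_rev, cs.inv_simple, map_mul]; simp [mul_assoc]
  exact ⟨i, e, by rw [e]; exact h⟩

lemma step_right (cs : CoxeterSystem M W) (δ : W ≃* W) (p : B ≃ B)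
    (hδ : ∀ i : B, δ (cs.simple i) = cs.simple (p i)) (y : W) (i : B)
    (h : Pos (-(rh cs (y⁻¹ * δ y) (al (p i))))) :
    TwistedStep cs δ (y⁻¹ * δ y) ((y * cs.simple i)⁻¹ * δ (y * cs.simple i)) := by
  apply step_of_length
  have h1 := cs.isRightDescent_iff.1 (descent_of_neg cs _ _ h)
  rw [mul_assoc, hδ]
  have := cs.length_mul_le (cs.simple i) (y⁻¹ * δ y * cs.simple (p i))
  rw [cs.length_simple] at this
  omega

lemma step_left (cs : CoxeterSystem M W) (δ : W ≃* W) (p : B ≃ B)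
    (hδ : ∀ i : B, δ (cs.simple i) = cs.simple (p i)) (y : W) (i : B)
    (h : Pos (-(rh cs ((δ y)⁻¹ * y) (al i)))) :
    TwistedStep cs δ (y⁻¹ * δ y) ((y * cs.simple i)⁻¹ * δ (y * cs.simple i)) := by
  apply step_of_length
  have h0 := descent_of_neg cs _ _ h
  have e : (δ y)⁻¹ * y = (y⁻¹ * δ y)⁻¹ := by simp
  rw [e, cs.isRightDescent_inv_iff] at h0
  have h1 := cs.isLeftDescent_iff.1 h0
  rw [hδ]
  have := cs.length_mul_le (cs.simple i * (y⁻¹ * δ y)) (cs.simple (p i))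
  rw [cs.length_simple] at this
  omega

lemma rh_word_apply (cs : CoxeterSystem M W) (ω : List B) (j : B) (hj : j ∉ ω) (v : B →₀ ℝ) :
    rh cs (cs.wordProd ω) v j = v j := by
  induction ω with
  | nil => simp
  | cons i ω ih =>
    simp only [List.mem_cons, not_or] at hj
    rw [cs.wordProd_cons, rh_mul, rh_simple, sg_apply, Finsupp.sub_apply, Finsupp.smul_apply,
      ih hj.2]
    simp [al, Finsupp.single_eq_of_ne hj.1]

lemma exists_neg_coord (cs : CoxeterSystem M W) (y : W) (b : B) (v : B →₀ ℝ) (hv : Pos v)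
    (h : rh cs y v b < 0) : ∃ i, rh cs y (al i) b < 0 := by
  by_contra hcon
  push Not at hcon
  have e : v = v.sum (fun i a => a • al i) := by
    simp [al]
  rw [e, map_finsuppSum, Finsupp.sum, Finsupp.finsetSum_apply] at h
  have : 0 ≤ ∑ k ∈ v.support, (rh cs y (v k • al k)) b := by
    apply Finset.sum_nonneg
    intro k _
    rw [map_smul, Finsupp.smul_apply, smul_eq_mul]
    exact mul_nonneg (hv k) (hcon k)
  linarith

theorem infinite_case (cs : CoxeterSystem M W) (δ : W ≃* W) (p : B ≃ B)
    (hδ : ∀ i : B, δ (cs.simple i) = cs.simple (p i)) (h : B → ℤ) (hh : ∀ i, h (p i) = h i + 1)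
    (n : ℕ) : ∀ y : W, cs.length y = n →
      Relation.ReflTransGen (TwistedStep cs δ) (y⁻¹ * δ y) 1 := by
  induction n with
  | zero =>
    intro y hy
    rw [cs.length_eq_zero_iff] at hy
    subst hy
    simpa using Relation.ReflTransGen.refl
  | succ n ih =>
    intro y hy
    obtain ⟨ω, hω, rfl⟩ := cs.exists_isReduced y
    have hne : ω ≠ [] := by
      rintro rfl
      simp at hy
    obtain ⟨b, hb, hmax⟩ : ∃ b ∈ ω, ∀ c ∈ ω, h c ≤ h b := by
      classical
      obtain ⟨b, hb, hm⟩ := Finset.exists_max_image ω.toFinset h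
        (by simpa using hne)
      exact ⟨b, by simpa using hb, fun c hc => hm c (by simpa using hc)⟩
    have hpb : p b ∉ ω := fun hc => by
      have := hmax _ hc
      rw [hh] at this
      omega
    obtain ⟨ω1, ω2, hsplit, hb1⟩ := List.eq_append_cons_of_mem hb
    have hred2 : cs.IsReduced (b :: ω2) := by
      have := hω.drop ω1.length
      rw [hsplit] at this
      simpa using this
    have hnd : ¬ cs.IsRightDescent (cs.wordProd ω2)⁻¹ b := by
      rw [cs.isRightDescent_inv_iff]
      intro hc
      have h1 := hc
      simp only [IsLeftDescent] at h1
      rw [← cs.wordProd_cons, hred2.eq] at h1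
      have := cs.length_wordProd_le ω2
      simp at h1
      omega
    have hpos := pos_of_not_descent cs _ _ b rfl hnd
    have hval : rh cs (cs.wordProd ω) (rh cs (cs.wordProd ω2)⁻¹ (al b)) b < 0 := by
      rw [hsplit, cs.wordProd_append, cs.wordProd_cons, rh_mul, rh_mul, rh_apply_inv,
        rh_simple_self, map_neg, Finsupp.neg_apply, rh_word_apply cs ω1 b hb1]
      simp [al]
    obtain ⟨i, hi⟩ := exists_neg_coord cs _ b _ hpos hval
    set y := cs.wordProd ω with hyd
    have hdesc : cs.IsRightDescent y i := by
      by_contra hc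
      have := pos_of_not_descent cs _ _ i rfl hc b
      linarith
    have hneg : rh cs (y⁻¹ * δ y) (al (p i)) (p b) < 0 := by
      rw [rh_mul, ← Pv_al, ← Pv_rh cs δ p hδ, hyd, ← cs.wordProd_reverse,
        rh_word_apply cs _ (p b) (by simpa using hpb), Pv_apply]
      exact hi
    have hneg' : Pos (-(rh cs (y⁻¹ * δ y) (al (p i)))) := by
      rcases pos_or_neg cs (y⁻¹ * δ y) (p i) with h' | h'
      · have := h' (p b)
        linarith
      · exact h'
    refine Relation.ReflTransGen.head (step_right cs δ p hδ y i hneg') (ih _ ?_)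
    have := cs.isRightDescent_iff.1 hdesc
    omega

end TwCob

namespace TwCob

/-- invariant bilinear form -/
noncomputable def bil (M : CoxeterMatrix B) : (B →₀ ℝ) →ₗ[ℝ] (B →₀ ℝ) →ₗ[ℝ] ℝ :=
  Finsupp.linearCombination ℝ (Bf M)

lemma bil_al (i : B) : bil M (al i) = Bf M i := by simp [bil, al]

lemma bil_symm (u v : B →₀ ℝ) : bil M u v = bil M v u := by
  have : bil M = (bil M).flip := by
    apply Finsupp.lhom_ext'
    intro i
    apply LinearMap.ext_ring
    apply Finsupp.lhom_ext'
    intro j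
    apply LinearMap.ext_ring
    show bil M (al i) (al j) = bil M (al j) (al i)
    rw [bil_al, bil_al, Bf_al, Bf_al, M.symmetric]
  exact LinearMap.congr_fun (LinearMap.congr_fun this u) v

lemma bil_sg (i : B) (u v : B →₀ ℝ) : bil M (sg M i u) (sg M i v) = bil M u v := by
  have h : bil M u (al i) = Bf M i u := by rw [bil_symm, bil_al]
  simp only [sg_apply, map_sub, map_smul, LinearMap.sub_apply, LinearMap.smul_apply, bil_al, h,
    Bf_self, smul_eq_mul]
  ring

lemma bil_rh (cs : CoxeterSystem M W) (w : W) : ∀ u v,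
    bil M (rh cs w u) (rh cs w v) = bil M u v := by
  induction w using cs.simple_induction_left with
  | one => simp
  | mul_simple_left w i ih =>
    intro u v
    rw [rh_mul, rh_mul, rh_simple, bil_sg, ih]

/-- roots -/
def Rt (cs : CoxeterSystem M W) : Set (B →₀ ℝ) := {β | ∃ u i, β = rh cs u (al i)}

lemma Rt_rh (cs : CoxeterSystem M W) (w : W) {β : B →₀ ℝ} (h : β ∈ Rt cs) :
    rh cs w β ∈ Rt cs := by
  obtain ⟨u, i, rfl⟩ := h
  exact ⟨w * u, i, by rw [rh_mul]⟩

lemma Rt_pos_or (cs : CoxeterSystem M W) {β : B →₀ ℝ} (h : β ∈ Rt cs) : Pos β ∨ Pos (-β) := by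
  obtain ⟨u, i, rfl⟩ := h
  exact pos_or_neg cs u i

lemma Rt_ne (cs : CoxeterSystem M W) {β : B →₀ ℝ} (h : β ∈ Rt cs) : β ≠ 0 := by
  obtain ⟨u, i, rfl⟩ := h
  exact rh_ne cs u i

lemma Rt_mult (cs : CoxeterSystem M W) {c : ℝ} {i : B} (h : c • al i ∈ Rt cs) (hc : 0 ≤ c) :
    c = 1 := by
  obtain ⟨u, j, hu⟩ := h
  have h1 : bil M (rh cs u (al j)) (rh cs u (al j)) = 2 := by rw [bil_rh, bil_al, Bf_self]
  rw [← hu] at h1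
  simp only [map_smul, LinearMap.smul_apply, bil_al, Bf_self, smul_eq_mul] at h1
  nlinarith

lemma eq_smul_al {i : B} {γ : B →₀ ℝ} (h1 : Pos γ) (h2 : Pos (-(sg M i γ))) :
    γ = γ i • al i := by
  ext j
  by_cases hj : j = i
  · subst hj; simp [al]
  · have a := h1 j
    have b := h2 j
    simp [sg_apply, al, Finsupp.single_eq_of_ne hj] at b
    simp [al, Finsupp.single_eq_of_ne hj]
    linarith

lemma finite_inv (cs : CoxeterSystem M W) (z : W) :
    {β | β ∈ Rt cs ∧ Pos β ∧ Pos (-(rh cs z β))}.Finite := by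
  induction z using cs.simple_induction_left with
  | one =>
    convert Set.finite_empty
    ext β
    simp only [Set.mem_setOf_eq, Set.mem_empty_iff_false, iff_false]
    rintro ⟨h, h1, h2⟩
    exact Rt_ne cs h (eq_zero_of_pos_neg h1 (by simpa using h2))
  | mul_simple_left z i ih =>
    apply (ih.union (Set.finite_singleton (rh cs z⁻¹ (al i)))).subset
    rintro β ⟨h, h1, h2⟩
    rw [rh_mul, rh_simple] at h2
    rcases Rt_pos_or cs (Rt_rh cs z h) with h3 | h3
    · right
      have e := eq_smul_al h3 h2
      have h4 := Rt_rh cs z h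
      rw [e] at h4
      have := Rt_mult cs h4 (h3 i)
      rw [this, one_smul] at e
      rw [Set.mem_singleton_iff, ← e, rh_inv_apply]
    · left; exact ⟨h, h1, h3⟩

section fin
variable [Fintype B]

/-- pairing -/
noncomputable def pr (x : B → ℝ) : (B →₀ ℝ) →ₗ[ℝ] ℝ := Finsupp.linearCombination ℝ x

lemma pr_sum (x : B → ℝ) (v : B →₀ ℝ) : pr x v = ∑ i, v i * x i := by
  simp [pr, Finsupp.linearCombination_apply, Finsupp.sum_fintype]

lemma pr_add (x y : B → ℝ) (v : B →₀ ℝ) : pr (x + y) v = pr x v + pr y v := by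
  simp [pr_sum, mul_add, Finset.sum_add_distrib]

lemma pr_smul (c : ℝ) (x : B → ℝ) (v : B →₀ ℝ) : pr (c • x) v = c * pr x v := by
  simp only [pr_sum, Finset.mul_sum, Pi.smul_apply, smul_eq_mul]
  exact Finset.sum_congr rfl fun i _ => by ring

/-- linear in the first variable -/
noncomputable def prL (v : B →₀ ℝ) : (B → ℝ) →ₗ[ℝ] ℝ where
  toFun x := pr x v
  map_add' x y := pr_add x y v
  map_smul' c x := by simp [pr_smul]

lemma pr_cont (v : B →₀ ℝ) : Continuous fun x : B → ℝ => pr x v := by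
  simp only [pr_sum]
  fun_prop

lemma pr_comp (p : B ≃ B) (x : B → ℝ) (v : B →₀ ℝ) : pr (x ∘ p) v = pr x (Pv p v) := by
  rw [pr_sum, pr_sum, ← p.sum_comp (fun i => Pv p v i * x i)]
  simp [Pv_apply]

lemma pos_decomp (L : (B →₀ ℝ) →ₗ[ℝ] ℝ) (v : B →₀ ℝ) : L v = ∑ i, v i * L (al i) := by
  have e : v = v.sum (fun i a => a • al i) := by simp [al]
  conv_lhs => rw [e]
  rw [map_finsuppSum, Finsupp.sum_fintype _ _ (by simp)]
  simp

/-- closed chamber -/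
def cl (cs : CoxeterSystem M W) (y : W) (x : B → ℝ) : Prop := ∀ i, 0 ≤ pr x (rh cs y (al i))

/-- open chamber -/
def op (cs : CoxeterSystem M W) (y : W) (x : B → ℝ) : Prop := ∀ i, 0 < pr x (rh cs y (al i))

variable (cs : CoxeterSystem M W)

lemma op.cl {y : W} {x : B → ℝ} (h : op cs y x) : cl cs y x := fun i => (h i).le

lemma cl_nonneg {y : W} {x : B → ℝ} (h : cl cs y x) {β : B →₀ ℝ} (hβ : Pos (rh cs y⁻¹ β)) :
    0 ≤ pr x β := by
  have := pos_decomp (pr x ∘ₗ rh cs y) (rh cs y⁻¹ β)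
  simp only [LinearMap.comp_apply, rh_apply_inv] at this
  rw [this]
  exact Finset.sum_nonneg fun i _ => mul_nonneg (hβ i) (h i)

lemma op_pos {y : W} {x : B → ℝ} (h : op cs y x) {β : B →₀ ℝ} (hβ : Pos (rh cs y⁻¹ β))
    (h0 : β ≠ 0) : 0 < pr x β := by
  have := pos_decomp (pr x ∘ₗ rh cs y) (rh cs y⁻¹ β)
  simp only [LinearMap.comp_apply, rh_apply_inv] at this
  rw [this]
  have hne : rh cs y⁻¹ β ≠ 0 := by
    intro hc
    apply h0
    rw [← rh_apply_inv cs y β, hc, map_zero]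
  obtain ⟨i, hi⟩ := Finsupp.ne_iff.1 hne
  apply Finset.sum_pos'
  · exact fun i _ => mul_nonneg (hβ i) (h i).le
  · exact ⟨i, Finset.mem_univ _, mul_pos (lt_of_le_of_ne (hβ i) (Ne.symm hi)) (h i)⟩

lemma neg_of_cl {y : W} {x : B → ℝ} (h : cl cs y x) {β : B →₀ ℝ} (hR : β ∈ Rt cs)
    (hβ : pr x β < 0) : Pos (-(rh cs y⁻¹ β)) := by
  rcases Rt_pos_or cs (Rt_rh cs y⁻¹ hR) with h' | h'
  · have := cl_nonneg cs h h'; linarith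
  · exact h'

lemma pos_of_op {y : W} {x : B → ℝ} (h : op cs y x) {β : B →₀ ℝ} (hR : β ∈ Rt cs)
    (hβ : 0 ≤ pr x β) : Pos (rh cs y⁻¹ β) := by
  rcases Rt_pos_or cs (Rt_rh cs y⁻¹ hR) with h' | h'
  · exact h'
  · rw [← map_neg] at h'
    have := op_pos cs h h' (neg_ne_zero.2 (Rt_ne cs hR))
    rw [map_neg] at this
    linarith

/-- roots positive at `y`, negative at a point of the closed chamber `z` -/
lemma finite_sep (y z : W) :
    {β | β ∈ Rt cs ∧ Pos (rh cs y⁻¹ β) ∧ Pos (-(rh cs z⁻¹ β))}.Finite := by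
  apply ((finite_inv cs (z⁻¹ * y)).image (rh cs y)).subset
  rintro β ⟨h, h1, h2⟩
  refine ⟨rh cs y⁻¹ β, ⟨Rt_rh cs _ h, h1, ?_⟩, rh_apply_inv cs y β⟩
  rwa [rh_mul, rh_apply_inv]

variable (δ : W ≃* W) (p : B ≃ B)

lemma rh_delta (hδ : ∀ i : B, δ (cs.simple i) = cs.simple (p i))
    (y : W) (i : B) : rh cs (δ y) (al (p i)) = Pv p (rh cs y (al i)) := by
  rw [Pv_rh cs δ p hδ, Pv_al]

lemma op_comp (hδ : ∀ i : B, δ (cs.simple i) = cs.simple (p i))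
    {z : W} {x : B → ℝ} (h : op cs z x) : op cs (δ.symm z) (x ∘ p) := by
  intro i
  rw [pr_comp, ← rh_delta cs δ p hδ]
  simpa using h (p i)

lemma cl_comp_symm (hδ : ∀ i : B, δ (cs.simple i) = cs.simple (p i))
    {z : W} {x : B → ℝ} (h : cl cs z x) : cl cs (δ z) (x ∘ p.symm) := by
  intro i
  obtain ⟨j, rfl⟩ := p.surjective i
  rw [rh_delta cs δ p hδ, ← pr_comp]
  have : (x ∘ p.symm) ∘ p = x := by ext; simp
  rw [this]
  exact h j

/-- the key local step -/
lemma cross (hδ : ∀ i : B, δ (cs.simple i) = cs.simple (p i))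
    {y : W} {x : B → ℝ} (h : cl cs y x) (i : B)
    (hneg : pr (x ∘ p) (rh cs y (al i)) + pr (x ∘ p.symm) (rh cs y (al i)) < 0) :
    TwistedStep cs δ (y⁻¹ * δ y) ((y * cs.simple i)⁻¹ * δ (y * cs.simple i)) := by
  have : pr (x ∘ p) (rh cs y (al i)) < 0 ∨ pr (x ∘ p.symm) (rh cs y (al i)) < 0 := by
    by_contra hc
    push Not at hc
    linarith [hc.1, hc.2]
  rcases this with h' | h'
  · apply step_right cs δ p hδ
    rw [pr_comp, ← rh_delta cs δ p hδ] at h'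
    rw [rh_mul]
    exact neg_of_cl cs h ⟨_, _, rfl⟩ h'
  · apply step_left cs δ p hδ
    rw [rh_mul]
    exact neg_of_cl cs (cl_comp_symm cs δ p hδ h) ⟨_, _, rfl⟩ h'

/-- walking inside the residue of `x` in the direction of a second point -/
lemma walk (hδ : ∀ i : B, δ (cs.simple i) = cs.simple (p i))
    (Q : W → Prop)
    (hQ : ∀ y i, Q y → TwistedStep cs δ (y⁻¹ * δ y)
      ((y * cs.simple i)⁻¹ * δ (y * cs.simple i)) → Q (y * cs.simple i))
    (x x' : B → ℝ) (hx' : ∀ v, pr x' v = (pr x v + pr (x ∘ p) v + pr (x ∘ p.symm) v) / 3)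
    (hfin : ∀ y, {β | β ∈ Rt cs ∧ pr x' β < 0 ∧ Pos (rh cs y⁻¹ β)}.Finite) (n : ℕ) :
    ∀ y, Q y → cl cs y x → {β | β ∈ Rt cs ∧ pr x' β < 0 ∧ Pos (rh cs y⁻¹ β)}.ncard = n →
    ∃ y', Q y' ∧ cl cs y' x ∧
      ∀ i, pr x (rh cs y' (al i)) = 0 → 0 ≤ pr x' (rh cs y' (al i)) := by
  induction n using Nat.strong_induction_on with
  | _ n IH =>
  intro y hy hcl hn
  by_cases hall : ∀ i, pr x (rh cs y (al i)) = 0 → 0 ≤ pr x' (rh cs y (al i))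
  · exact ⟨y, hy, hcl, hall⟩
  push Not at hall
  obtain ⟨i, h0, hi⟩ := hall
  have hstep := cross cs δ p hδ hcl i (by
    have := hx' (rh cs y (al i))
    rw [this, h0] at hi
    linarith)
  have hsi : ∀ v, rh cs (y * cs.simple i) v = rh cs y v - Bf M i v • rh cs y (al i) := by
    intro v
    rw [rh_mul, rh_simple, sg_apply, map_sub, map_smul]
  refine IH _ ?_ (y * cs.simple i) (hQ y i hy hstep) ?_ rfl
  · rw [← hn]
    apply Set.ncard_lt_ncard _ (hfin y)
    rw [Set.ssubset_iff_of_subset]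
    · refine ⟨rh cs y (al i), ⟨⟨_, _, rfl⟩, hi, ?_⟩, ?_⟩
      · rw [rh_inv_apply]; exact pos_al i
      · rintro ⟨-, -, h3⟩
        rw [mul_inv_rev, rh_mul, rh_inv_apply, cs.inv_simple, rh_simple_self] at h3
        exact al_ne i (eq_zero_of_pos_neg (pos_al i) h3)
    · rintro β ⟨hR, h1, h2⟩
      refine ⟨hR, h1, ?_⟩
      rw [mul_inv_rev, rh_mul, cs.inv_simple, rh_simple] at h2
      rcases Rt_pos_or cs (Rt_rh cs y⁻¹ hR) with h3 | h3
      · exact h3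
      · exfalso
        have e := eq_smul_al (M := M) (i := i) h3 (by rw [map_neg, neg_neg]; exact h2)
        have e2 : -β = (-(rh cs y⁻¹ β)) i • rh cs y (al i) := by
          rw [← map_smul, ← e, map_neg, rh_apply_inv]
        have e3 := congrArg (pr x') e2
        rw [map_neg, map_smul, smul_eq_mul] at e3
        have := h3 i
        nlinarith
  · intro j
    rw [hsi, map_sub, map_smul, h0]
    simpa using hcl j

end fin

end TwCob

namespace TwCob

section fin2
variable [Fintype B]

/-- sum over the orbit -/
noncomputable def av (p : Equiv.Perm B) (x : B → ℝ) : B → ℝ :=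
  ∑ k ∈ Finset.range (orderOf p), x ∘ (p ^ k : Equiv.Perm B)

lemma av_comp (p : Equiv.Perm B) (x : B → ℝ) : av p (x ∘ p) = av p x := by
  have h : ∀ k : ℕ, (x ∘ p) ∘ (p ^ k : Equiv.Perm B) = x ∘ (p ^ (k + 1) : Equiv.Perm B) := by
    intro k; ext j; simp [pow_succ']
  simp only [av, h]
  have h1 := Finset.sum_range_succ (fun k => x ∘ (p ^ k : Equiv.Perm B)) (orderOf p)
  have h2 := Finset.sum_range_succ' (fun k => x ∘ (p ^ k : Equiv.Perm B)) (orderOf p)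
  rw [h1, pow_orderOf_eq_one, pow_zero] at h2
  exact (add_right_cancel h2).symm

lemma av_pow (p : Equiv.Perm B) (x : B → ℝ) (k : ℕ) :
    av p (x ∘ (p ^ k : Equiv.Perm B)) = av p x := by
  induction k with
  | zero => simp
  | succ k ih =>
    have : x ∘ (p ^ (k + 1) : Equiv.Perm B) = (x ∘ (p ^ k : Equiv.Perm B)) ∘ p := by
      ext j; simp [pow_succ]
    rw [this, av_comp, ih]

lemma av_fixed (p : Equiv.Perm B) (x : B → ℝ) (h : x ∘ p = x) :
    av p x = (orderOf p : ℝ) • x := by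
  have : ∀ k : ℕ, x ∘ (p ^ k : Equiv.Perm B) = x := by
    intro k
    induction k with
    | zero => simp
    | succ k ih =>
      have : x ∘ (p ^ (k + 1) : Equiv.Perm B) = (x ∘ (p ^ k : Equiv.Perm B)) ∘ p := by
        ext j; simp [pow_succ]
      rw [this, ih, h]
  simp only [av, this]
  ext j
  simp

lemma av_lin (p : Equiv.Perm B) (a b : ℝ) (x y : B → ℝ) :
    av p (a • x + b • y) = a • av p x + b • av p y := by
  simp only [av, Finset.smul_sum, ← Finset.sum_add_distrib]
  rfl

variable (cs : CoxeterSystem M W)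

lemma exists_generic (p : Equiv.Perm B) (y0 : W) :
    ∃ x0 : B → ℝ, op cs y0 x0 ∧ ∀ β ∈ Rt cs, pr (av p x0) β ≠ 0 := by
  let a : B → ℝ := fun i => pr 1 (rh cs y0⁻¹ (al i))
  have ha : ∀ v, pr a v = pr 1 (rh cs y0⁻¹ v) := by
    intro v
    have := pos_decomp (pr 1 ∘ₗ rh cs y0⁻¹) v
    rw [pr_sum]
    exact this.symm
  have hone : ∀ i : B, pr 1 (al i) = 1 := by intro i; simp [pr, al]
  obtain ⟨C, hC⟩ : ∃ C : ℝ, ∀ i, -pr 1 (rh cs y0 (al i)) ≤ C := by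
    obtain ⟨C, hC⟩ := (Set.finite_range fun i => -pr 1 (rh cs y0 (al i))).bddAbove
    exact ⟨C, fun i => hC ⟨i, rfl⟩⟩
  have hpos1 : ∀ β ∈ Rt cs, pr 1 β ≠ 0 := by
    have hop : op cs 1 (1 : B → ℝ) := by intro i; simp [hone]
    intro β hβ
    rcases Rt_pos_or cs hβ with h | h
    · exact (op_pos cs hop (by simpa using h) (Rt_ne cs hβ)).ne'
    · have := op_pos cs hop (β := -β) (by simpa using h) (neg_ne_zero.2 (Rt_ne cs hβ))
      rw [map_neg] at this
      linarith
  have hcount : (Rt cs).Countable := by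
    have : Countable W := cs.wordProd_surjective.countable
    have : Rt cs = Set.range (fun q : W × B => rh cs q.1 (al q.2)) := by
      ext β
      constructor
      · rintro ⟨u, i, rfl⟩; exact ⟨(u, i), rfl⟩
      · rintro ⟨⟨u, i⟩, rfl⟩; exact ⟨u, i, rfl⟩
    rw [this]
    exact Set.countable_range _
  have hbad : (⋃ β ∈ Rt cs, {T : ℝ | pr (av p (T • a + (1 : ℝ) • 1)) β = 0}).Countable := by
    apply hcount.biUnion
    intro β hβ
    apply Set.Subsingleton.countable
    intro T hT T' hT'
    simp only [Set.mem_setOf_eq, av_lin, pr_add, pr_smul] at hT hT'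
    by_contra hne
    have h1 : (T - T') * pr (av p a) β = 0 := by linarith
    have h2 := (mul_eq_zero.1 h1).resolve_left (sub_ne_zero.2 hne)
    rw [h2, av_fixed p 1 rfl, pr_smul] at hT
    have h3 : (orderOf p : ℝ) ≠ 0 := by
      exact_mod_cast (orderOf_pos p).ne'
    have := hpos1 β hβ
    simp [h3, this] at hT
  obtain ⟨T, hT, hT'⟩ := (hbad.dense_compl ℝ).inter_open_nonempty (Set.Ioi C) isOpen_Ioi
    ⟨C + 1, by simp⟩
  refine ⟨T • a + (1 : ℝ) • 1, ?_, ?_⟩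
  · intro i
    rw [pr_add, pr_smul, pr_smul, ha, rh_inv_apply, hone]
    have := hC i
    have : C < T := hT
    linarith
  · intro β hβ h0
    apply hT'
    simp only [Set.mem_iUnion]
    exact ⟨β, hβ, h0⟩

theorem finite_case (δ : W ≃* W) (p : Equiv.Perm B)
    (hδ : ∀ i : B, δ (cs.simple i) = cs.simple (p i)) (y0 : W) :
    Relation.ReflTransGen (TwistedStep cs δ) (y0⁻¹ * δ y0) 1 := by
  obtain ⟨x0, hx0, hgen⟩ := exists_generic cs p y0
  let Q : W → Prop := fun y =>
    Relation.ReflTransGen (TwistedStep cs δ) (y0⁻¹ * δ y0) (y⁻¹ * δ y)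
  have hQ : ∀ y i, Q y → TwistedStep cs δ (y⁻¹ * δ y)
      ((y * cs.simple i)⁻¹ * δ (y * cs.simple i)) → Q (y * cs.simple i) :=
    fun y i h h' => Relation.ReflTransGen.tail h h'
  let P : Set (B → ℝ) := Set.range fun k : ℕ => x0 ∘ (p ^ k : Equiv.Perm B)
  have hPfin : P.Finite := by
    apply (Set.finite_range fun g : Equiv.Perm B => x0 ∘ g).subset
    rintro _ ⟨k, rfl⟩
    exact ⟨p ^ k, rfl⟩
  have hPop : ∀ q ∈ P, ∃ z, op cs z q := by
    rintro _ ⟨k, rfl⟩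
    induction k with
    | zero => exact ⟨y0, by simpa using hx0⟩
    | succ k ih =>
      obtain ⟨z, hz⟩ := ih
      refine ⟨δ.symm z, ?_⟩
      have : x0 ∘ (p ^ (k + 1) : Equiv.Perm B) = (x0 ∘ (p ^ k : Equiv.Perm B)) ∘ p := by
        ext j; simp [pow_succ]
      simp only [this]
      exact op_comp cs δ p hδ hz
  let K : Set (B → ℝ) := convexHull ℝ P
  have hKc : IsCompact K := hPfin.isCompact_convexHull ℝ
  have hKconv : Convex ℝ K := convex_convexHull ℝ P
  have hKp : ∀ x ∈ K, x ∘ p ∈ K := by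
    have hc : Convex ℝ ((LinearMap.funLeft ℝ ℝ p) ⁻¹' K) := hKconv.linear_preimage _
    have : K ⊆ (LinearMap.funLeft ℝ ℝ p) ⁻¹' K := by
      apply convexHull_min _ hc
      rintro _ ⟨k, rfl⟩
      apply subset_convexHull
      refine ⟨k + 1, ?_⟩
      ext j; simp [pow_succ, LinearMap.funLeft_apply]
    intro x hx
    exact this hx
  have hKpk : ∀ (k : ℕ), ∀ x ∈ K, x ∘ (p ^ k : Equiv.Perm B) ∈ K := by
    intro k
    induction k with
    | zero => intro x hx; simpa using hx
    | succ k ih =>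
      intro x hx
      have : x ∘ (p ^ (k + 1) : Equiv.Perm B) = (x ∘ (p ^ k : Equiv.Perm B)) ∘ p := by
        ext j; simp [pow_succ]
      rw [this]
      exact hKp _ (ih x hx)
  have hKps : ∀ x ∈ K, x ∘ p.symm ∈ K := by
    intro x hx
    have : p.symm = p ^ (orderOf p - 1) := by
      have h1 : p ^ (orderOf p - 1) * p = 1 := by
        rw [← pow_succ, Nat.sub_add_cancel (orderOf_pos p), pow_orderOf_eq_one]
      exact (eq_inv_of_mul_eq_one_left h1).symm
    rw [this]
    exact hKpk _ x hx
  have hKneg : ∀ β, (∀ q ∈ P, pr q β < 0) → ∀ x ∈ K, pr x β < 0 := by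
    intro β h
    have : K ⊆ {x | prL β x < 0} :=
      convexHull_min h (convex_halfSpace_lt (prL β).isLinear 0)
    exact fun x hx => this hx
  have hKnn : ∀ β, (∀ q ∈ P, 0 ≤ pr q β) → ∀ x ∈ K, 0 ≤ pr x β := by
    intro β h
    have : K ⊆ {x | 0 ≤ prL β x} :=
      convexHull_min h (convex_halfSpace_ge (prL β).isLinear 0)
    exact fun x hx => this hx
  have hKav : ∀ x ∈ K, av p x = av p x0 := by
    have hc : Convex ℝ {x | av p x = av p x0} := by
      intro x hx y hy a b _ _ hab
      simp only [Set.mem_setOf_eq] at hx hy ⊢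
      rw [av_lin, hx, hy, ← add_smul, hab, one_smul]
    have : K ⊆ {x | av p x = av p x0} := by
      apply convexHull_min _ hc
      rintro _ ⟨k, rfl⟩
      exact av_pow p x0 k
    exact fun x hx => this hx
  -- finiteness of the mixed roots
  let Mix : Set (B →₀ ℝ) := {β | β ∈ Rt cs ∧ (∃ q ∈ P, pr q β < 0) ∧ ∃ q ∈ P, 0 ≤ pr q β}
  have hMix : Mix.Finite := by
    have : (⋃ q ∈ P, ⋃ q' ∈ P, {β | β ∈ Rt cs ∧ pr q β < 0 ∧ 0 ≤ pr q' β}).Finite := by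
      apply hPfin.biUnion
      intro q hq
      apply hPfin.biUnion
      intro q' hq'
      obtain ⟨z, hz⟩ := hPop q hq
      obtain ⟨z', hz'⟩ := hPop q' hq'
      apply (finite_sep cs z' z).subset
      rintro β ⟨h, h1, h2⟩
      exact ⟨h, pos_of_op cs hz' h h2, neg_of_cl cs hz.cl h h1⟩
    apply this.subset
    rintro β ⟨h, ⟨q, hq, h1⟩, q', hq', h2⟩
    simp only [Set.mem_iUnion]
    exact ⟨q, hq, q', hq', h, h1, h2⟩
  have hN : ∀ x ∈ K, ∀ y, {β | β ∈ Rt cs ∧ pr x β < 0 ∧ Pos (rh cs y⁻¹ β)}.Finite := by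
    intro x hx y
    have : (⋃ q ∈ P, {β | β ∈ Rt cs ∧ pr q β < 0 ∧ Pos (rh cs y⁻¹ β)}).Finite := by
      apply hPfin.biUnion
      intro q hq
      obtain ⟨z, hz⟩ := hPop q hq
      apply (finite_sep cs y z).subset
      rintro β ⟨h, h1, h2⟩
      exact ⟨h, h2, neg_of_cl cs hz.cl h h1⟩
    apply this.subset
    rintro β ⟨h, h1, h2⟩
    have : ∃ q ∈ P, pr q β < 0 := by
      by_contra hc
      push Not at hc
      have := hKnn β hc x hx
      linarith
    obtain ⟨q, hq, hq'⟩ := this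
    simp only [Set.mem_iUnion]
    exact ⟨q, hq, h, hq', h2⟩
  let S : Set (B → ℝ) := {x | x ∈ K ∧ ∃ y, Q y ∧ cl cs y x}
  have hSclosed : IsClosed S := by
    rw [← closure_subset_iff_isClosed]
    intro x hx
    have hxK : x ∈ K := by
      have : closure S ⊆ K := closure_minimal (fun x hx => hx.1) hKc.isClosed
      exact this hx
    have hev : ∀ᶠ x' in nhds x, ∀ β ∈ Mix, pr x β < 0 → pr x' β < 0 := by
      rw [Filter.eventually_all_finite hMix]
      intro β _
      by_cases h : pr x β < 0
      · filter_upwards [(pr_cont β).continuousAt.eventually (gt_mem_nhds h)] with x' hx' _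
        exact hx'
      · exact Filter.Eventually.of_forall fun x' h' => absurd h' h
    obtain ⟨x', ⟨hx'K, y, hy, hcl⟩, hx'⟩ :=
      ((mem_closure_iff_frequently.1 hx).and_eventually hev).exists
    refine ⟨hxK, y, hy, ?_⟩
    intro i
    by_contra hneg
    push Not at hneg
    have hR : rh cs y (al i) ∈ Rt cs := ⟨_, _, rfl⟩
    have hge := hcl i
    by_cases hm : rh cs y (al i) ∈ Mix
    · have := hx' _ hm hneg
      linarith
    · have h1 : ∃ q ∈ P, pr q (rh cs y (al i)) < 0 := by
        by_contra hc
        push Not at hc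
        have := hKnn _ hc x hxK
        linarith
      have h2 : ∀ q ∈ P, pr q (rh cs y (al i)) < 0 := by
        by_contra hc
        push Not at hc
        exact hm ⟨hR, h1, hc⟩
      have := hKneg _ h2 x' hx'K
      linarith
  have hScomp : IsCompact S := hKc.of_isClosed_subset hSclosed fun x hx => hx.1
  have hSne : S.Nonempty := by
    refine ⟨x0, subset_convexHull ℝ P ⟨0, by simp⟩, y0, Relation.ReflTransGen.refl, hx0.cl⟩
  let f : (B → ℝ) → ℝ := fun x => ∑ i, x i ^ 2
  have hf : Continuous f := by simp only [f]; fun_prop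
  obtain ⟨x, ⟨hxK, y, hy, hcl⟩, hmin⟩ := hScomp.exists_isMinOn hSne hf.continuousOn
  -- the minimum is fixed
  have hfix : x ∘ p = x := by
    by_contra hne
    let x' : B → ℝ := (1 / 3 : ℝ) • x + (2 / 3 : ℝ) • ((1 / 2 : ℝ) • (x ∘ p) +
      (1 / 2 : ℝ) • (x ∘ p.symm))
    have hx'K : x' ∈ K :=
      hKconv hxK (hKconv (hKp x hxK) (hKps x hxK) (by norm_num) (by norm_num) (by norm_num))
        (by norm_num) (by norm_num) (by norm_num)
    have hx'pr : ∀ v, pr x' v = (pr x v + pr (x ∘ p) v + pr (x ∘ p.symm) v) / 3 := by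
      intro v
      simp only [x', pr_add, pr_smul]
      ring
    obtain ⟨y', hy', hcl', hdir⟩ := walk cs δ p hδ Q hQ x x' hx'pr (hN x' hx'K) _ y hy hcl rfl
    have hfx' : f x' < f x := by
      have e1 : f (x ∘ p) = f x := by
        simp only [f, Function.comp]
        exact Equiv.sum_comp p (fun i => x i ^ 2)
      have e2 : f (x ∘ p.symm) = f x := by
        simp only [f, Function.comp]
        exact Equiv.sum_comp p.symm (fun i => x i ^ 2)
      obtain ⟨j, hj⟩ := Function.ne_iff.1 hne
      have h1 : ∀ i, x' i ^ 2 + (1 / 9) * (x (p i) - x i) ^ 2 ≤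
          (1 / 3) * (x i ^ 2 + (x ∘ p) i ^ 2 + (x ∘ p.symm) i ^ 2) := by
        intro i
        have : x' i = (x i + x (p i) + x (p.symm i)) / 3 := by
          simp only [x', Pi.add_apply, Pi.smul_apply, smul_eq_mul, Function.comp]
          ring
        rw [this]
        simp only [Function.comp]
        nlinarith [sq_nonneg (x i - x (p.symm i)), sq_nonneg (x (p i) - x (p.symm i))]
      have h2 := Finset.sum_le_sum fun i (_ : i ∈ Finset.univ) => h1 i
      rw [Finset.sum_add_distrib, ← Finset.mul_sum, ← Finset.mul_sum, Finset.sum_add_distrib,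
        Finset.sum_add_distrib] at h2
      change f x' + _ ≤ 1 / 3 * (f x + f (x ∘ p) + f (x ∘ p.symm)) at h2
      rw [e1, e2] at h2
      have h3 : 0 < ∑ i, (x (p i) - x i) ^ 2 := by
        apply Finset.sum_pos'
        · intro i _; positivity
        · refine ⟨j, Finset.mem_univ _, ?_⟩
          have : x (p j) - x j ≠ 0 := sub_ne_zero.2 hj
          positivity
      linarith
    have hev : ∀ᶠ e in nhdsWithin (0 : ℝ) (Set.Ioi 0), ∀ i,
        0 ≤ (1 - e) * pr x (rh cs y' (al i)) + e * pr x' (rh cs y' (al i)) := by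
      rw [Filter.eventually_all]
      intro i
      rcases eq_or_lt_of_le (hcl' i) with h0 | h0
      · have := hdir i h0.symm
        filter_upwards [self_mem_nhdsWithin] with e he
        rw [← h0]
        have he' : 0 < e := he
        rw [mul_zero, zero_add]
        exact mul_nonneg he'.le this
      · apply Filter.Eventually.filter_mono nhdsWithin_le_nhds
        have hc : Continuous fun e : ℝ =>
            (1 - e) * pr x (rh cs y' (al i)) + e * pr x' (rh cs y' (al i)) := by fun_prop
        filter_upwards [hc.continuousAt.eventually
          (lt_mem_nhds (a := 0) (b := (1 - (0 : ℝ)) * pr x (rh cs y' (al i)) +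
            0 * pr x' (rh cs y' (al i))) (by simpa using h0))] with e he
        exact he.le
    have hlt1 : ∀ᶠ e in nhdsWithin (0 : ℝ) (Set.Ioi 0), e < 1 :=
      Filter.Eventually.filter_mono nhdsWithin_le_nhds (gt_mem_nhds (by norm_num))
    have hgt0 : ∀ᶠ e in nhdsWithin (0 : ℝ) (Set.Ioi 0), e ∈ Set.Ioi (0 : ℝ) :=
      self_mem_nhdsWithin
    obtain ⟨e, he, he1, he0⟩ := (hev.and (hlt1.and hgt0)).exists
    have he0' : 0 < e := he0
    let z : B → ℝ := (1 - e) • x + e • x'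
    have hzS : z ∈ S := by
      refine ⟨hKconv hxK hx'K (by linarith) he0'.le (by ring), y', hy', ?_⟩
      intro i
      simp only [z, pr_add, pr_smul]
      exact he i
    have hz : f x ≤ f z := hmin hzS
    have hz2 : f z ≤ (1 - e) * f x + e * f x' := by
      simp only [f, Finset.mul_sum, ← Finset.sum_add_distrib]
      apply Finset.sum_le_sum
      intro i _
      simp only [z, Pi.add_apply, Pi.smul_apply, smul_eq_mul]
      nlinarith [mul_nonneg (mul_nonneg he0'.le (sub_nonneg.2 he1.le)) (sq_nonneg (x i - x' i))]
    nlinarith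
  -- conclusion
  have hne : ∀ β ∈ Rt cs, pr x β ≠ 0 := by
    intro β hβ h0
    apply hgen β hβ
    rw [← hKav x hxK, av_fixed p x hfix, pr_smul, h0, mul_zero]
  have hop : op cs y x := fun i => lt_of_le_of_ne (hcl i) (Ne.symm (hne _ ⟨_, _, rfl⟩))
  have hw : y⁻¹ * δ y = 1 := by
    by_contra hw
    obtain ⟨j, hj⟩ := cs.exists_rightDescent_of_ne_one hw
    have h1 := neg_of_descent cs _ j hj
    rw [rh_mul, ← map_neg] at h1
    have h2 := op_pos cs hop h1 (neg_ne_zero.2 (rh_ne cs _ _))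
    have h3 := cl_comp_symm cs δ p hδ hcl j
    have : x ∘ p.symm = x := by
      conv_lhs => rw [← hfix]
      ext j; simp
    rw [this] at h3
    rw [map_neg] at h2
    linarith
  have : Q y := hy
  simp only [Q, hw] at this
  exact this

end fin2

end TwCob

/-- If every standard parabolic subgroup `W_J` for a proper `δ`-stable `J ⊆ I` is finite,
then for every `x ∈ W` one has `x δ(x)⁻¹ →_δ 1`. -/
theorem twisted_coboundary_reduces_to_one
    (cs : CoxeterSystem M W) (δ : W ≃* W) (p : B ≃ B)
    (hδ : ∀ i : B, δ (cs.simple i) = cs.simple (p i))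
    (hfin : ∀ J : Set B, J ≠ Set.univ → p '' J = J →
      (Subgroup.closure (cs.simple '' J) : Set W).Finite) :
    ∀ x : W, Relation.ReflTransGen (TwistedStep cs δ) (x * (δ x)⁻¹) 1 := by
  intro x
  have e : x * (δ x)⁻¹ = (x⁻¹)⁻¹ * δ x⁻¹ := by simp
  rw [e]
  rcases finite_or_infinite B with hB | hB
  · have := Fintype.ofFinite B
    exact TwCob.finite_case cs δ p hδ x⁻¹
  · have hJfin : ∀ J : Set B, J ≠ Set.univ → p '' J = J → J.Finite := by
      intro J h1 h2
      have h3 := (hfin J h1 h2).subset Subgroup.subset_closure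
      exact h3.of_finite_image (TwCob.simple_inj cs).injOn
    obtain ⟨i0⟩ : Nonempty B := inferInstance
    let p' : Equiv.Perm B := p
    let O : Set B := Set.range fun k : ℤ => (p' ^ k) i0
    have hO : p '' O = O := by
      ext j
      constructor
      · rintro ⟨_, ⟨k, rfl⟩, rfl⟩
        refine ⟨k + 1, ?_⟩
        show (p' ^ (k + 1)) i0 = p' ((p' ^ k) i0)
        rw [add_comm, zpow_add, zpow_one]; rfl
      · rintro ⟨k, rfl⟩
        refine ⟨(p' ^ (k - 1)) i0, ⟨_, rfl⟩, ?_⟩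
        show p' ((p' ^ (k - 1)) i0) = (p' ^ k) i0
        have : p' ^ k = p' * p' ^ (k - 1) := by
          rw [← zpow_one_add]; congr 1; ring
        rw [this]; rfl
    have hOu : O = Set.univ := by
      by_contra hne
      have h1 := hJfin O hne hO
      have h2 := hJfin Oᶜ (by
        intro h
        have : i0 ∈ Oᶜ := by rw [h]; trivial
        exact this ⟨0, rfl⟩) (by rw [Set.image_compl_eq p.bijective, hO])
      have := h1.union h2
      rw [Set.union_compl_self] at this
      exact Set.infinite_univ this
    have hsurj : ∀ j : B, ∃ k : ℤ, (p' ^ k) i0 = j := fun j => by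
      have : j ∈ O := by rw [hOu]; trivial
      exact this
    have hinj : Function.Injective fun k : ℤ => (p' ^ k) i0 := by
      intro k l hkl
      by_contra hne
      obtain ⟨n, hn0, hn⟩ : ∃ n : ℤ, 0 < n ∧ (p' ^ n) i0 = i0 := by
        have key : ∀ a b : ℤ, (p' ^ a) i0 = (p' ^ b) i0 → (p' ^ (a - b)) i0 = i0 := by
          intro a b hab
          rw [sub_eq_neg_add, zpow_add, Equiv.Perm.mul_apply, hab, ← Equiv.Perm.mul_apply,
            ← zpow_add]
          simp
        rcases lt_or_gt_of_ne hne with h | h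
        · exact ⟨l - k, by omega, key l k hkl.symm⟩
        · exact ⟨k - l, by omega, key k l hkl⟩
      have hnm : ∀ q : ℤ, (p' ^ (n * q)) i0 = i0 := by
        intro q
        rw [zpow_mul]
        exact Equiv.Perm.zpow_apply_eq_self_of_apply_eq_self hn q
      have hsub : O ⊆ (fun k : ℤ => (p' ^ k) i0) '' Set.Ico 0 n := by
        rintro _ ⟨k, rfl⟩
        refine ⟨k % n, ⟨Int.emod_nonneg _ hn0.ne', Int.emod_lt_of_pos _ hn0⟩, ?_⟩
        have : k = k % n + n * (k / n) := (Int.emod_add_mul_ediv k n).symm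
        show (p' ^ (k % n)) i0 = (p' ^ k) i0
        conv_rhs => rw [this, zpow_add, Equiv.Perm.mul_apply, hnm]
      have := ((Set.finite_Ico 0 n).image (fun k : ℤ => (p' ^ k) i0)).subset hsub
      rw [hOu] at this
      exact Set.infinite_univ this
    choose h hh using hsurj
    refine TwCob.infinite_case cs δ p hδ h ?_ _ x⁻¹ rfl
    intro i
    apply hinj
    show (p' ^ h (p i)) i0 = (p' ^ (h i + 1)) i0
    rw [hh, add_comm, zpow_add, zpow_one, Equiv.Perm.mul_apply, hh]
end

section
/- Let (W, I) be a Coxeter group, J, J' ⊆ I, and δ: W_J → W_{J'} an isomorphism with δ(J) = J'. For w ∈ W^{J'}, define σ: W_{I(w,δ)} → W_{I(w,δ)} by σ(v) = δ(w v w⁻¹). Then the map v ↦ w v induces a bijection between the σ-twisted conjugacy classes in W_{I(w,δ)} and the orbits of the twisted W_J-action x · y = x y δ(x)⁻¹ on the piece [w, δ] = W_J · (w W_{I(w,δ)}). -/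
open CoxeterSystem

variable {B W : Type*} [Group W] {M : CoxeterMatrix B}

/-- The standard parabolic subgroup `W_J`. -/
def StdParabolic (cs : CoxeterSystem M W) (J : Set B) : Subgroup W :=
  Subgroup.closure (cs.simple '' J)

/-- `K ⊆ J'` is stable for `(w, δ)`. -/
def StableSubset (cs : CoxeterSystem M W) (J J' : Set B) (δ : W → W) (w : W)
    (K : Set B) : Prop :=
  K ⊆ J' ∧ (∀ k ∈ K, ∃ j ∈ J, w * cs.simple k * w⁻¹ = cs.simple j) ∧
    (fun k => δ (w * cs.simple k * w⁻¹)) '' K = cs.simple '' K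

/-- `I(w, δ)`: the maximal subset `K ⊆ J'` with `δ(Ad w)K = K`. -/
def ISet (cs : CoxeterSystem M W) (J J' : Set B) (δ : W → W) (w : W) : Set B :=
  ⋃₀ {K : Set B | StableSubset cs J J' δ w K}

open Classical in
/-- The generators acting on `W × ZMod 2`, used for the exchange property. -/
noncomputable def exchGen (cs : CoxeterSystem M W) (i : B) : Function.End (W × ZMod 2) :=
  fun p => (cs.simple i * p.1 * cs.simple i, p.2 + if p.1 = cs.simple i then 1 else 0)

open Classical in
theorem exchGen_pow (cs : CoxeterSystem M W) (i j : B) (n : ℕ) (t : W) (e : ZMod 2) :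
    ((exchGen cs i * exchGen cs j) ^ n) (t, e) =
      ((cs.simple i * cs.simple j) ^ n * t * ((cs.simple i * cs.simple j) ^ n)⁻¹,
        e + ∑ k ∈ Finset.range (2 * n),
          if cs.simple j * t = (cs.simple i * cs.simple j) ^ k then 1 else 0) := by
  have key : ∀ k : ℕ, ((cs.simple i * cs.simple j) ^ k)⁻¹ * cs.simple j =
      cs.simple j * (cs.simple i * cs.simple j) ^ k := by
    intro k
    induction k with
    | zero => simp
    | succ k ih =>
      have h1 : (cs.simple i * cs.simple j)⁻¹ * cs.simple j
          = cs.simple j * (cs.simple i * cs.simple j) := by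
        simp [mul_assoc]
      rw [pow_succ, mul_inv_rev, mul_assoc, ih, ← mul_assoc, h1]
      rw [mul_assoc (cs.simple j), ← pow_succ', pow_succ]
  induction n with
  | zero =>
    change (t, e) = _
    simp
  | succ n ih =>
    set r := cs.simple i * cs.simple j with hr
    have e1 : (r ^ n * t * (r ^ n)⁻¹ = cs.simple j) ↔ cs.simple j * t = r ^ (2 * n) := by
      rw [mul_inv_eq_iff_eq_mul, ← eq_inv_mul_iff_mul_eq, ← mul_assoc, key, mul_assoc, ← pow_add,
        ← two_mul, ← inv_mul_eq_iff_eq_mul, cs.inv_simple]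
    have e2 : (cs.simple j * (r ^ n * t * (r ^ n)⁻¹) * cs.simple j = cs.simple i) ↔
        cs.simple j * t = r ^ (2 * n + 1) := by
      have e3 : cs.simple j * (r ^ n * t * (r ^ n)⁻¹) * cs.simple j = cs.simple i ↔
          r ^ n * t * (r ^ n)⁻¹ = cs.simple j * r := by
        rw [← eq_mul_inv_iff_mul_eq, ← eq_inv_mul_iff_mul_eq, cs.inv_simple]
      rw [e3, mul_inv_eq_iff_eq_mul, ← eq_inv_mul_iff_mul_eq, mul_assoc (cs.simple j), ← mul_assoc,
        key, mul_assoc, ← pow_succ', ← pow_add, ← inv_mul_eq_iff_eq_mul, cs.inv_simple,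
        show n + (n + 1) = 2 * n + 1 by ring]
    rw [pow_succ', show 2 * (n + 1) = 2 * n + 1 + 1 by ring, Finset.sum_range_succ,
      Finset.sum_range_succ]
    change exchGen cs i (exchGen cs j (((exchGen cs i * exchGen cs j) ^ n) (t, e))) = _
    rw [ih]
    simp only [exchGen, e1, e2]
    refine Prod.ext ?_ ?_
    · simp only [pow_succ']
      rw [hr]
      simp [mul_assoc]
    · simp only [add_assoc]

theorem exchGen_liftable (cs : CoxeterSystem M W) : M.IsLiftable (exchGen cs) := by
  classical
  intro i j
  funext ⟨t, e⟩
  rw [exchGen_pow]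
  have h := cs.simple_mul_simple_pow i j
  rw [two_mul, Finset.sum_range_add]
  simp only [pow_add, h, one_mul, mul_one, inv_one]
  rw [CharTwo.add_self_eq_zero]
  change _ = (t, e)
  simp

/-- The lifted action. -/
noncomputable def exchHom (cs : CoxeterSystem M W) : W →* Function.End (W × ZMod 2) :=
  cs.lift ⟨exchGen cs, exchGen_liftable cs⟩

theorem exchHom_simple (cs : CoxeterSystem M W) (i : B) :
    exchHom cs (cs.simple i) = exchGen cs i := cs.lift_apply_simple _ i

theorem exchHom_word (cs : CoxeterSystem M W) (ω : List B) (t : W) :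
    ∃ N : ZMod 2, (∀ e, exchHom cs (cs.wordProd ω) (t, e) =
        (cs.wordProd ω * t * (cs.wordProd ω)⁻¹, e + N)) ∧
      (N ≠ 0 → ∃ j < ω.length, cs.wordProd ω * t = cs.wordProd (ω.eraseIdx j)) := by
  classical
  induction ω with
  | nil =>
    refine ⟨0, fun e => ?_, fun h => absurd rfl h⟩
    simp only [cs.wordProd_nil, map_one]
    change (t, e) = _
    simp
  | cons i ω ih =>
    obtain ⟨N, h1, h2⟩ := ih
    refine ⟨N + if cs.wordProd ω * t * (cs.wordProd ω)⁻¹ = cs.simple i then 1 else 0,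
      fun e => ?_, ?_⟩
    · rw [cs.wordProd_cons, map_mul, exchHom_simple]
      change exchGen cs i (exchHom cs (cs.wordProd ω) (t, e)) = _
      rw [h1]
      simp [exchGen, mul_assoc, add_assoc]
    · intro hN
      by_cases hc : cs.wordProd ω * t * (cs.wordProd ω)⁻¹ = cs.simple i
      · refine ⟨0, by simp, ?_⟩
        rw [mul_inv_eq_iff_eq_mul] at hc
        rw [cs.wordProd_cons, mul_assoc, hc]
        simp
      · rw [if_neg hc, add_zero] at hN
        obtain ⟨j, hj, h⟩ := h2 hN
        refine ⟨j + 1, by simpa using hj, ?_⟩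
        rw [cs.wordProd_cons, mul_assoc, h, List.eraseIdx_cons_succ, cs.wordProd_cons]

theorem exchange (cs : CoxeterSystem M W) (ω : List B) (i : B)
    (h : cs.length (cs.wordProd ω * cs.simple i) < cs.length (cs.wordProd ω)) :
    ∃ j < ω.length, cs.wordProd ω * cs.simple i = cs.wordProd (ω.eraseIdx j) := by
  obtain ⟨N, h1, h2⟩ := exchHom_word cs ω (cs.simple i)
  apply h2
  rintro rfl
  obtain ⟨τ, hτ, hτe⟩ := cs.exists_isReduced (cs.wordProd ω * cs.simple i)
  obtain ⟨N', h1', h2'⟩ := exchHom_word cs τ (cs.simple i)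
  have : N' ≠ 0 := by
    have h3 := h1' 0
    rw [← hτe, map_mul, exchHom_simple] at h3
    change exchHom cs (cs.wordProd ω) (exchGen cs i (cs.simple i, 0)) = _ at h3
    have h6 : exchGen cs i (cs.simple i, 0) = (cs.simple i, 1) := by simp [exchGen]
    rw [h6, h1] at h3
    have h4 := congrArg Prod.snd h3
    simp only [add_zero, zero_add] at h4
    rw [← h4]; decide
  obtain ⟨j, hj, he⟩ := h2' this
  rw [← hτe] at he
  simp only [cs.simple_mul_simple_cancel_right] at he
  have h5 := cs.length_wordProd_le (τ.eraseIdx j)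
  rw [← he, List.length_eraseIdx_of_lt hj, ← hτ, ← hτe] at h5
  omega

theorem mem_parabolic_iff (cs : CoxeterSystem M W) (T : Set B) (z : W) :
    z ∈ StdParabolic cs T ↔ ∃ ω : List B, (∀ i ∈ ω, i ∈ T) ∧ cs.IsReduced ω ∧
      cs.wordProd ω = z := by
  constructor
  · intro hz
    have step : ∀ (z : W), (∃ ω : List B, (∀ i ∈ ω, i ∈ T) ∧ cs.IsReduced ω ∧
        cs.wordProd ω = z) → ∀ i ∈ T, (∃ ω : List B, (∀ i ∈ ω, i ∈ T) ∧ cs.IsReduced ω ∧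
        cs.wordProd ω = z * cs.simple i) := by
      rintro _ ⟨ω, h1, h2, rfl⟩ i hi
      rcases cs.length_mul_simple (cs.wordProd ω) i with h | h
      · refine ⟨ω ++ [i], ?_, ?_, by simp [cs.wordProd_append]⟩
        · simp only [List.mem_append, List.mem_singleton]
          rintro k (hk | rfl)
          exacts [h1 k hk, hi]
        · have := h2.eq
          simp only [CoxeterSystem.IsReduced, cs.wordProd_append, cs.wordProd_singleton,
            List.length_append, List.length_singleton]
          omega
      · obtain ⟨j, hj, he⟩ := exchange cs ω i (by omega)
        refine ⟨ω.eraseIdx j, fun k hk => h1 k (List.mem_of_mem_eraseIdx hk), ?_, he.symm⟩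
        have := h2.eq
        rw [CoxeterSystem.IsReduced, ← he, List.length_eraseIdx_of_lt hj]
        omega
    unfold StdParabolic at hz
    induction hz using Subgroup.closure_induction_right with
    | one => exact ⟨[], by simp, by simp [CoxeterSystem.IsReduced], by simp⟩
    | mul_right x hx y hy ih =>
      obtain ⟨i, hi, rfl⟩ := hy
      exact step _ ih i hi
    | mul_inv_cancel x hx y hy ih =>
      obtain ⟨i, hi, rfl⟩ := hy
      rw [cs.inv_simple]
      exact step _ ih i hi
  · rintro ⟨ω, h1, -, rfl⟩
    apply Subgroup.list_prod_mem
    simp only [List.mem_map]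
    rintro _ ⟨i, hi, rfl⟩
    exact Subgroup.subset_closure ⟨i, h1 i hi, rfl⟩

theorem wordProd_mem (cs : CoxeterSystem M W) (T : Set B) (ω : List B) (h : ∀ i ∈ ω, i ∈ T) :
    cs.wordProd ω ∈ StdParabolic cs T := by
  apply Subgroup.list_prod_mem
  simp only [List.mem_map]
  rintro _ ⟨i, hi, rfl⟩
  exact Subgroup.subset_closure ⟨i, h i hi, rfl⟩

theorem simple_mem (cs : CoxeterSystem M W) (T : Set B) (i : B) (h : i ∈ T) :
    cs.simple i ∈ StdParabolic cs T := Subgroup.subset_closure ⟨i, h, rfl⟩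

theorem simple_of_mem (cs : CoxeterSystem M W) (T : Set B) (z : W) (hz : z ∈ StdParabolic cs T)
    (hl : cs.length z = 1) : z ∈ cs.simple '' T := by
  obtain ⟨ω, h1, h2, rfl⟩ := (mem_parabolic_iff cs T z).1 hz
  rw [h2.eq, List.length_eq_one_iff] at hl
  obtain ⟨i, rfl⟩ := hl
  exact ⟨i, h1 i (by simp), by simp⟩

theorem isReduced_left (cs : CoxeterSystem M W) {ω τ : List B} (h : cs.IsReduced (ω ++ τ)) :
    cs.IsReduced ω := by
  simpa using h.take ω.length

theorem letters_of_mem (cs : CoxeterSystem M W) (T : Set B) (ω : List B) (hr : cs.IsReduced ω)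
    (hz : cs.wordProd ω ∈ StdParabolic cs T) : ∀ i ∈ ω, cs.simple i ∈ cs.simple '' T := by
  induction ω using List.reverseRecOn with
  | nil => simp
  | append_singleton ω k ih =>
    have hr' := isReduced_left cs hr
    obtain ⟨τ, t1, t2, t3⟩ := (mem_parabolic_iff cs T _).1 hz
    have hk : cs.simple k ∈ StdParabolic cs T := by
      have hlt : cs.length (cs.wordProd τ * cs.simple k) < cs.length (cs.wordProd τ) := by
        rw [t3, hr.eq, cs.wordProd_append, cs.wordProd_singleton,
          cs.simple_mul_simple_cancel_right, hr'.eq]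
        simp
      obtain ⟨j, hj, he⟩ := exchange cs τ k hlt
      have : cs.simple k = (cs.wordProd τ)⁻¹ * cs.wordProd (τ.eraseIdx j) := by
        rw [← he]; simp
      rw [this]
      exact mul_mem (inv_mem (wordProd_mem cs T τ t1))
        (wordProd_mem cs T _ fun i hi => t1 i (List.mem_of_mem_eraseIdx hi))
    have hz' : cs.wordProd ω ∈ StdParabolic cs T := by
      rw [cs.wordProd_append, cs.wordProd_singleton] at hz
      exact (Subgroup.mul_mem_cancel_right _ hk).1 hz
    intro i hi
    rcases List.mem_append.1 hi with hi | hi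
    · exact ih hr' hz' i hi
    · rw [List.mem_singleton.1 hi]
      exact simple_of_mem cs T _ hk (cs.length_simple k)

/-- Lengths add for minimal coset representatives. -/
theorem length_min_mul (cs : CoxeterSystem M W) (T : Set B) (w : W)
    (hw : ∀ u ∈ StdParabolic cs T, cs.length w ≤ cs.length (w * u))
    (τ : List B) (hτ : cs.IsReduced τ) (hT : ∀ i ∈ τ, i ∈ T) :
    cs.length (w * cs.wordProd τ) = cs.length w + τ.length := by
  induction τ using List.reverseRecOn with
  | nil => simp
  | append_singleton τ k ih =>
    have hr := isReduced_left cs hτ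
    have hTτ : ∀ i ∈ τ, i ∈ T := fun i hi => hT i (by simp [hi])
    have hk : k ∈ T := hT k (by simp)
    have ih := ih hr hTτ
    obtain ⟨ω, hω, rfl⟩ := cs.exists_isReduced w
    rw [cs.wordProd_append, cs.wordProd_singleton, ← mul_assoc, List.length_append,
      List.length_singleton]
    rcases cs.length_mul_simple (cs.wordProd ω * cs.wordProd τ) k with h | h
    · omega
    · exfalso
      obtain ⟨j, hj, he⟩ := exchange cs (ω ++ τ) k (by rw [cs.wordProd_append]; omega)
      rcases lt_or_ge j ω.length with hjω | hjω
      · rw [List.eraseIdx_append_of_lt_length hjω, cs.wordProd_append, cs.wordProd_append] at he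
        have h1 := hw (cs.wordProd τ * cs.simple k * (cs.wordProd τ)⁻¹)
          (mul_mem (mul_mem (wordProd_mem cs T τ hTτ) (simple_mem cs T k hk))
            (inv_mem (wordProd_mem cs T τ hTτ)))
        rw [← mul_assoc, ← mul_assoc, he, mul_inv_cancel_right] at h1
        have h2 := cs.length_wordProd_le (ω.eraseIdx j)
        rw [List.length_eraseIdx_of_lt hjω] at h2
        have := hω.eq
        omega
      · rw [List.eraseIdx_append_of_length_le hjω, cs.wordProd_append, cs.wordProd_append,
          mul_assoc] at he
        have he := mul_left_cancel he
        have h1 := hτ.eq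
        rw [cs.wordProd_append, cs.wordProd_singleton, he] at h1
        have h2 := cs.length_wordProd_le (τ.eraseIdx (j - ω.length))
        rw [List.length_append] at hj
        rw [List.length_eraseIdx_of_lt (by omega)] at h2
        simp only [List.length_append, List.length_singleton] at h1
        omega

/-- Words whose conjugate by `w` lies in `W_J` and is not longer. -/
def GoodWord (cs : CoxeterSystem M W) (J J' : Set B) (w : W) (τ : List B) : Prop :=
  cs.IsReduced τ ∧ (∀ i ∈ τ, i ∈ J') ∧ w * cs.wordProd τ * w⁻¹ ∈ StdParabolic cs J ∧
    cs.length (w * cs.wordProd τ * w⁻¹) ≤ τ.length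

theorem GoodWord.dropLast {cs : CoxeterSystem M W} {J J' : Set B} {w : W}
    (hw : ∀ u ∈ StdParabolic cs J', cs.length w ≤ cs.length (w * u))
    {τ : List B} {k : B} (h : GoodWord cs J J' w (τ ++ [k])) : GoodWord cs J J' w τ := by
  obtain ⟨h1, h2, h3, h4⟩ := h
  have hr := isReduced_left cs h1
  have hτ : ∀ i ∈ τ, i ∈ J' := fun i hi => h2 i (by simp [hi])
  obtain ⟨ρ, r1, r2, r3⟩ := (mem_parabolic_iff cs J _).1 h3
  obtain ⟨ω, hω, rfl⟩ := cs.exists_isReduced w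
  have l1 := length_min_mul cs J' _ hw _ h1 h2
  have l2 := length_min_mul cs J' _ hw _ hr hτ
  have r4 : cs.wordProd (ρ ++ ω) = cs.wordProd ω * cs.wordProd (τ ++ [k]) := by
    rw [cs.wordProd_append, r3]; simp
  have r5 : cs.wordProd (ρ ++ ω) * cs.simple k = cs.wordProd ω * cs.wordProd τ := by
    rw [r4, cs.wordProd_append]; simp [mul_assoc]
  obtain ⟨j, hj, he⟩ := exchange cs (ρ ++ ω) k (by
    rw [r5, r4, l1, l2]; simp)
  rcases lt_or_ge j ρ.length with hjρ | hjρ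
  · rw [List.eraseIdx_append_of_lt_length hjρ, r5, cs.wordProd_append,
      ← mul_inv_eq_iff_eq_mul] at he
    refine ⟨hr, hτ, ?_, ?_⟩
    · rw [he]
      exact wordProd_mem cs J _ fun i hi => r1 i (List.mem_of_mem_eraseIdx hi)
    · rw [he]
      have := cs.length_wordProd_le (ρ.eraseIdx j)
      rw [List.length_eraseIdx_of_lt hjρ] at this
      rw [← r3, r2.eq, List.length_append, List.length_singleton] at h4
      omega
  · exfalso
    rw [List.eraseIdx_append_of_length_le hjρ, cs.wordProd_append, cs.wordProd_append,
      mul_assoc] at he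
    have he := mul_left_cancel he
    have h5 := hw _ (simple_mem cs J' k (h2 k (by simp)))
    rw [he] at h5
    have h6 := cs.length_wordProd_le (ω.eraseIdx (j - ρ.length))
    rw [List.length_append] at hj
    rw [List.length_eraseIdx_of_lt (by omega)] at h6
    have := hω.eq
    omega

theorem GoodWord.reverse {cs : CoxeterSystem M W} {J J' : Set B} {w : W}
    {τ : List B} (h : GoodWord cs J J' w τ) : GoodWord cs J J' w τ.reverse := by
  obtain ⟨h1, h2, h3, h4⟩ := h
  have e : w * cs.wordProd τ.reverse * w⁻¹ = (w * cs.wordProd τ * w⁻¹)⁻¹ := by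
    simp [mul_assoc]
  refine ⟨h1.reverse, by simpa using h2, ?_, ?_⟩
  · rw [e]; exact inv_mem h3
  · rw [e, cs.length_inv]; simpa using h4

theorem GoodWord.tail {cs : CoxeterSystem M W} {J J' : Set B} {w : W}
    (hw : ∀ u ∈ StdParabolic cs J', cs.length w ≤ cs.length (w * u))
    {τ : List B} {k : B} (h : GoodWord cs J J' w (k :: τ)) : GoodWord cs J J' w τ := by
  have h1 := h.reverse
  rw [List.reverse_cons] at h1
  simpa using (h1.dropLast hw).reverse

theorem GoodWord.head {cs : CoxeterSystem M W} {J J' : Set B} {w : W}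
    (hw : ∀ u ∈ StdParabolic cs J', cs.length w ≤ cs.length (w * u))
    {τ : List B} {k : B} (h : GoodWord cs J J' w (k :: τ)) : GoodWord cs J J' w [k] := by
  induction τ using List.reverseRecOn with
  | nil => exact h
  | append_singleton τ l ih =>
    exact ih (GoodWord.dropLast hw (τ := k :: τ) (k := l) h)

theorem GoodWord.letters {cs : CoxeterSystem M W} {J J' : Set B} {w : W}
    (hw : ∀ u ∈ StdParabolic cs J', cs.length w ≤ cs.length (w * u))
    {τ : List B} (h : GoodWord cs J J' w τ) :
    ∀ k ∈ τ, ∃ j ∈ J, w * cs.simple k * w⁻¹ = cs.simple j := by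
  induction τ with
  | nil => simp
  | cons l τ ih =>
    intro k hk
    rcases List.mem_cons.1 hk with rfl | hk
    · obtain ⟨-, -, h3, h4⟩ := h.head hw
      rw [cs.wordProd_singleton] at h3 h4
      have : cs.length (w * cs.simple k * w⁻¹) ≠ 0 := by
        rw [Ne, cs.length_eq_zero_iff]
        intro h0
        have h1 : cs.simple k = 1 := by
          rw [mul_inv_eq_one] at h0
          exact mul_eq_left.1 h0
        have := cs.length_simple k
        rw [h1, cs.length_one] at this
        omega
      simp only [List.length_singleton] at h4
      obtain ⟨j, hj, he⟩ := simple_of_mem cs J _ h3 (by omega)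
      exact ⟨j, hj, he.symm⟩
    · exact ih (h.tail hw) k hk

theorem iSet_stable (cs : CoxeterSystem M W) (J J' : Set B) (δ : W → W) (w : W) :
    StableSubset cs J J' δ w (ISet cs J J' δ w) := by
  refine ⟨?_, ?_, ?_⟩
  · rintro k ⟨K, hK, hk⟩
    exact hK.1 hk
  · rintro k ⟨K, hK, hk⟩
    exact hK.2.1 k hk
  · apply Set.Subset.antisymm
    · rintro _ ⟨k, ⟨K, hK, hk⟩, rfl⟩
      have : (fun k => δ (w * cs.simple k * w⁻¹)) k ∈ cs.simple '' K := by
        rw [← hK.2.2]; exact ⟨k, hk, rfl⟩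
      obtain ⟨l, hl, he⟩ := this
      exact ⟨l, ⟨K, hK, hl⟩, he⟩
    · rintro _ ⟨k, ⟨K, hK, hk⟩, rfl⟩
      have : cs.simple k ∈ (fun k => δ (w * cs.simple k * w⁻¹)) '' K := by
        rw [hK.2.2]; exact ⟨k, hk, rfl⟩
      obtain ⟨l, hl, he⟩ := this
      exact ⟨l, ⟨K, hK, hl⟩, he⟩

theorem length_le_delta (cs : CoxeterSystem M W) (J J' : Set B) (δ : W → W)
    (hbij : Set.BijOn δ (StdParabolic cs J) (StdParabolic cs J'))
    (hmul : ∀ a ∈ StdParabolic cs J, ∀ b ∈ StdParabolic cs J, δ (a * b) = δ a * δ b)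
    (hsim : δ '' (cs.simple '' J) = cs.simple '' J') (δ1 : δ 1 = 1)
    (x : W) (hx : x ∈ StdParabolic cs J) : cs.length x ≤ cs.length (δ x) := by
  have lift : ∀ ω : List B, (∀ i ∈ ω, i ∈ J') →
      ∃ ρ : List B, (∀ i ∈ ρ, i ∈ J) ∧ ρ.length = ω.length ∧
        δ (cs.wordProd ρ) = cs.wordProd ω := by
    intro ω
    induction ω with
    | nil => intro _; exact ⟨[], by simp, rfl, by simpa using δ1⟩
    | cons i ω ih =>
      intro h
      obtain ⟨ρ, h1, h2, h3⟩ := ih fun k hk => h k (by simp [hk])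
      have : cs.simple i ∈ δ '' (cs.simple '' J) := by
        rw [hsim]; exact ⟨i, h i (by simp), rfl⟩
      obtain ⟨_, ⟨j, hj, rfl⟩, he⟩ := this
      refine ⟨j :: ρ, ?_, by simp [h2], ?_⟩
      · intro k hk
        rcases List.mem_cons.1 hk with rfl | hk
        exacts [hj, h1 k hk]
      · rw [cs.wordProd_cons, hmul _ (simple_mem cs J j hj) _ (wordProd_mem cs J ρ h1), he, h3,
          cs.wordProd_cons]
  obtain ⟨ω, h1, h2, h3⟩ := (mem_parabolic_iff cs J' _).1 (hbij.mapsTo hx)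
  obtain ⟨ρ, r1, r2, r3⟩ := lift ω h1
  have : cs.wordProd ρ = x := hbij.injOn (wordProd_mem cs J ρ r1) hx (r3.trans h3)
  rw [← h3, h2.eq, ← r2, ← this]
  exact cs.length_wordProd_le ρ

theorem parabolic_mono (cs : CoxeterSystem M W) {S T : Set B}
    (h : cs.simple '' S ⊆ cs.simple '' T) : StdParabolic cs S ≤ StdParabolic cs T :=
  Subgroup.closure_mono h

/-- Corollary 2.6(2): for `w ∈ W^{J'}` and `σ(v) = δ(w v w⁻¹)`, the map `v ↦ w v` induces a
bijection between the `σ`-twisted conjugacy classes in `W_{I(w,δ)}` and the orbits of the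
twisted `W_J`-action `x · y = x y δ(x)⁻¹` on `[w, δ] = W_J · (w W_{I(w,δ)})`. -/
theorem twisted_classes_biject_orbits_in_piece
    (cs : CoxeterSystem M W) (J J' : Set B) (δ : W → W)
    (hbij : Set.BijOn δ (StdParabolic cs J) (StdParabolic cs J'))
    (hmul : ∀ a ∈ StdParabolic cs J, ∀ b ∈ StdParabolic cs J, δ (a * b) = δ a * δ b)
    (hsim : δ '' (cs.simple '' J) = cs.simple '' J')
    (w : W) (hw : ∀ u ∈ StdParabolic cs J', cs.length w ≤ cs.length (w * u)) :
    (∀ u ∈ StdParabolic cs (ISet cs J J' δ w),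
        δ (w * u * w⁻¹) ∈ StdParabolic cs (ISet cs J J' δ w)) ∧
    (∀ v ∈ StdParabolic cs (ISet cs J J' δ w),
      ∀ v' ∈ StdParabolic cs (ISet cs J J' δ w),
        ((∃ x ∈ StdParabolic cs J, w * v' = x * (w * v) * (δ x)⁻¹) ↔
          (∃ u ∈ StdParabolic cs (ISet cs J J' δ w),
            v' = u * v * (δ (w * u * w⁻¹))⁻¹))) := by
  set K := ISet cs J J' δ w with hKdef
  have hK : StableSubset cs J J' δ w K := iSet_stable cs J J' δ w
  have δ1 : δ 1 = 1 := by
    have h := hmul 1 (one_mem _) 1 (one_mem _)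
    rw [mul_one] at h
    exact (mul_eq_left.1 h.symm)
  have hKJ' : StdParabolic cs K ≤ StdParabolic cs J' := parabolic_mono cs (Set.image_mono hK.1)
  -- conjugation by `w` sends `W_K` into `W_J`
  have conjmem : ∀ u ∈ StdParabolic cs K, w * u * w⁻¹ ∈ StdParabolic cs J := by
    have : StdParabolic cs K ≤ (StdParabolic cs J).comap (MulAut.conj w).toMonoidHom := by
      refine (Subgroup.closure_le _).2 ?_
      rintro _ ⟨k, hk, rfl⟩
      obtain ⟨j, hj, he⟩ := hK.2.1 k hk
      change w * cs.simple k * w⁻¹ ∈ StdParabolic cs J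
      rw [he]
      exact simple_mem cs J j hj
    exact fun u hu => this hu
  have conjsplit : ∀ a b : W, w * (a * b) * w⁻¹ = (w * a * w⁻¹) * (w * b * w⁻¹) := by
    intro a b; group
  have σmul : ∀ a b : W, w * a * w⁻¹ ∈ StdParabolic cs J → w * b * w⁻¹ ∈ StdParabolic cs J →
      δ (w * (a * b) * w⁻¹) = δ (w * a * w⁻¹) * δ (w * b * w⁻¹) := by
    intro a b ha hb
    rw [conjsplit, hmul _ ha _ hb]
  -- words
  have σword : ∀ τ : List B, (∀ k ∈ τ, w * cs.simple k * w⁻¹ ∈ StdParabolic cs J) →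
      w * cs.wordProd τ * w⁻¹ ∈ StdParabolic cs J ∧
      δ (w * cs.wordProd τ * w⁻¹) = (τ.map fun k => δ (w * cs.simple k * w⁻¹)).prod := by
    intro τ
    induction τ with
    | nil => intro _; simp [δ1, one_mem]
    | cons k τ ih =>
      intro h
      obtain ⟨i1, i2⟩ := ih fun l hl => h l (by simp [hl])
      have hk := h k (by simp)
      rw [cs.wordProd_cons, σmul _ _ hk i1, conjsplit, i2]
      exact ⟨mul_mem hk i1, by simp⟩
  have σmem : ∀ u ∈ StdParabolic cs K, δ (w * u * w⁻¹) ∈ StdParabolic cs K := by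
    intro u hu
    obtain ⟨τ, h1, -, rfl⟩ := (mem_parabolic_iff cs K u).1 hu
    rw [(σword τ fun k hk => conjmem _ (simple_mem cs K k (h1 k hk))).2]
    apply Subgroup.list_prod_mem
    simp only [List.mem_map]
    rintro _ ⟨k, hk, rfl⟩
    apply Subgroup.subset_closure
    rw [← hK.2.2]
    exact ⟨k, h1 k hk, rfl⟩
  have σsurj : ∀ u ∈ StdParabolic cs K, ∃ u' ∈ StdParabolic cs K, δ (w * u' * w⁻¹) = u := by
    intro u hu
    obtain ⟨τ, h1, -, rfl⟩ := (mem_parabolic_iff cs K u).1 hu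
    clear hu
    induction τ with
    | nil => exact ⟨1, one_mem _, by simp [δ1]⟩
    | cons k τ ih =>
      obtain ⟨u', hu', he⟩ := ih fun l hl => h1 l (by simp [hl])
      have : cs.simple k ∈ (fun k => δ (w * cs.simple k * w⁻¹)) '' K := by
        rw [hK.2.2]; exact ⟨k, h1 k (by simp), rfl⟩
      obtain ⟨l, hl, hle⟩ := this
      have hl' := simple_mem cs K l hl
      refine ⟨cs.simple l * u', mul_mem hl' hu', ?_⟩
      rw [σmul _ _ (conjmem _ hl') (conjmem _ hu'), he, cs.wordProd_cons]
      exact congrArg (· * _) hle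
  refine ⟨σmem, fun v hv v' hv' => ⟨?_, ?_⟩⟩
  swap
  · rintro ⟨u, hu, rfl⟩
    exact ⟨w * u * w⁻¹, conjmem u hu, by group⟩
  rintro ⟨x, hx, hxe⟩
  obtain ⟨z, rfl⟩ : ∃ z, x = w * z * w⁻¹ := ⟨w⁻¹ * x * w, by group⟩
  have hσz : δ (w * z * w⁻¹) = v'⁻¹ * z * v := by
    have h1 : w * v' * δ (w * z * w⁻¹) = w * z * w⁻¹ * (w * v) := by
      rw [hxe]; simp
    have h2 : w * (v' * δ (w * z * w⁻¹)) = w * (z * v) := by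
      rw [← mul_assoc, h1]; group
    have h3 := mul_left_cancel h2
    rw [mul_assoc v'⁻¹, ← h3, inv_mul_cancel_left]
  have hzJ' : z ∈ StdParabolic cs J' := by
    have h1 : z = v' * δ (w * z * w⁻¹) * v⁻¹ := by rw [hσz]; group
    rw [h1]
    exact mul_mem (mul_mem (hKJ' hv') (hbij.mapsTo hx)) (inv_mem (hKJ' hv))
  suffices hz : z ∈ StdParabolic cs K by
    exact ⟨z, hz, by rw [hσz]; group⟩
  -- a shortest element of the double coset
  obtain ⟨c0, ⟨a0, ha0, b0, hb0, hc0⟩, hmin⟩ : ∃ c0 : W,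
      (∃ a ∈ StdParabolic cs K, ∃ b ∈ StdParabolic cs K, c0 = a * z * b) ∧
      ∀ a ∈ StdParabolic cs K, ∀ b ∈ StdParabolic cs K,
        cs.length c0 ≤ cs.length (a * z * b) := by
    let S : Set W := {c | ∃ a ∈ StdParabolic cs K, ∃ b ∈ StdParabolic cs K, c = a * z * b}
    have hS : S.Nonempty := ⟨z, 1, one_mem _, 1, one_mem _, by simp⟩
    refine ⟨Function.argminOn cs.length S hS, Function.argminOn_mem cs.length S hS, ?_⟩
    intro a ha b hb
    exact Function.argminOn_le cs.length S ⟨a, ha, b, hb, rfl⟩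
  obtain ⟨a, ha, hσa⟩ := σsurj (a0 * v') (mul_mem ha0 hv')
  obtain ⟨b, hb, hσb⟩ := σsurj (v⁻¹ * b0) (mul_mem (inv_mem hv) hb0)
  have hcJ : w * (a * z * b) * w⁻¹ ∈ StdParabolic cs J := by
    rw [conjsplit, conjsplit]
    exact mul_mem (mul_mem (conjmem a ha) hx) (conjmem b hb)
  have hσc : δ (w * (a * z * b) * w⁻¹) = c0 := by
    rw [σmul _ _ (by rw [conjsplit]; exact mul_mem (conjmem a ha) hx) (conjmem b hb),
      σmul _ _ (conjmem a ha) hx, hσa, hσb, hσz, hc0]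
    group
  have hcJ' : a * z * b ∈ StdParabolic cs J' := mul_mem (mul_mem (hKJ' ha) hzJ') (hKJ' hb)
  have hzc : ∀ T : Set B, cs.simple '' K ⊆ cs.simple '' T →
      (z ∈ StdParabolic cs T ↔ a * z * b ∈ StdParabolic cs T) := by
    intro T hT
    have hKT := parabolic_mono cs hT
    rw [Subgroup.mul_mem_cancel_right _ (hKT hb), Subgroup.mul_mem_cancel_left _ (hKT ha)]
  have hzc0 : ∀ T : Set B, cs.simple '' K ⊆ cs.simple '' T →
      (z ∈ StdParabolic cs T ↔ c0 ∈ StdParabolic cs T) := by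
    intro T hT
    have hKT := parabolic_mono cs hT
    rw [hc0, Subgroup.mul_mem_cancel_right _ (hKT hb0), Subgroup.mul_mem_cancel_left _ (hKT ha0)]
  rw [hzc K le_rfl]
  have hmin' := hmin a ha b hb
  clear_value K
  generalize a * z * b = c at *
  obtain ⟨τ, t1, t2, rfl⟩ := (mem_parabolic_iff cs J' c).1 hcJ'
  have l1 := length_le_delta cs J J' δ hbij hmul hsim δ1 _ hcJ
  rw [hσc] at l1
  have l2 := t2.eq
  have good : GoodWord cs J J' w τ := ⟨t2, t1, hcJ, by omega⟩
  have letters := good.letters hw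
  have lettersJ : ∀ k ∈ τ, w * cs.simple k * w⁻¹ ∈ StdParabolic cs J := by
    intro k hk
    obtain ⟨j, hj, he⟩ := letters k hk
    rw [he]
    exact simple_mem cs J j hj
  have l3 : τ.length ≤ cs.length (w * cs.wordProd τ * w⁻¹) := by
    have h1 := length_min_mul cs J' w hw τ t2 t1
    have h2 := cs.length_mul_le (w * cs.wordProd τ * w⁻¹) w
    rw [inv_mul_cancel_right] at h2
    omega
  -- the word of `c0`
  obtain ⟨τ', hτ'⟩ : ∃ τ' : List B,
      τ'.map cs.simple = τ.map fun k => δ (w * cs.simple k * w⁻¹) := by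
    have : ∀ k ∈ τ, ∃ l : B, cs.simple l = δ (w * cs.simple k * w⁻¹) := by
      intro k hk
      obtain ⟨j, hj, he⟩ := letters k hk
      have : δ (cs.simple j) ∈ cs.simple '' J' := by
        rw [← hsim]; exact ⟨_, ⟨j, hj, rfl⟩, rfl⟩
      obtain ⟨l, -, hl⟩ := this
      exact ⟨l, by rw [hl, he]⟩
    have h2 : (τ.map fun k => δ (w * cs.simple k * w⁻¹)) ∈ Set.range (List.map cs.simple) := by
      rw [Set.range_list_map]
      intro y hy
      obtain ⟨k, hk, rfl⟩ := List.mem_map.1 hy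
      exact this k hk
    exact h2
  have hτ'c : cs.wordProd τ' = c0 := by
    rw [← hσc, (σword τ lettersJ).2, ← hτ']
    rfl
  have hτ'l : τ'.length = τ.length := by simpa using congrArg List.length hτ'
  have hτ'r : cs.IsReduced τ' := by
    have := cs.length_wordProd_le τ'
    rw [CoxeterSystem.IsReduced]
    rw [hτ'c] at *
    omega
  set S : Set B := K ∪ {i | i ∈ τ} with hS
  have hKS : K ⊆ S := Set.subset_union_left
  have hcS : cs.wordProd τ ∈ StdParabolic cs S := wordProd_mem cs S τ fun i hi => Or.inr hi
  have fτ : ∀ k ∈ τ, δ (w * cs.simple k * w⁻¹) ∈ cs.simple '' S := by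
    have hc0S : c0 ∈ StdParabolic cs S :=
      (hzc0 S (Set.image_mono hKS)).1 ((hzc S (Set.image_mono hKS)).2 hcS)
    intro k hk
    have : δ (w * cs.simple k * w⁻¹) ∈ τ'.map cs.simple := by
      rw [hτ']; exact List.mem_map.2 ⟨k, hk, rfl⟩
    obtain ⟨l, hl, he⟩ := List.mem_map.1 this
    rw [← he]
    exact letters_of_mem cs S τ' hτ'r (hτ'c ▸ hc0S) l hl
  have stab : StableSubset cs J J' δ w S := by
    refine ⟨?_, ?_, ?_⟩
    · rintro k (hk | hk)
      exacts [hK.1 hk, t1 k hk]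
    · rintro k (hk | hk)
      exacts [hK.2.1 k hk, letters k hk]
    · apply Set.Subset.antisymm
      · rintro _ ⟨k, hk | hk, rfl⟩
        · apply Set.image_mono hKS
          rw [← hK.2.2]
          exact ⟨k, hk, rfl⟩
        · exact fτ k hk
      · let T : Set B := {i | cs.simple i ∈ (fun k => δ (w * cs.simple k * w⁻¹)) '' S}
        have hKT : K ⊆ T := by
          intro k hk
          have : cs.simple k ∈ cs.simple '' K := ⟨k, hk, rfl⟩
          rw [← hK.2.2] at this
          exact Set.image_mono hKS this
        have hc0T : c0 ∈ StdParabolic cs T := by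
          rw [← hτ'c]
          apply wordProd_mem
          intro i hi
          have : cs.simple i ∈ τ'.map cs.simple := List.mem_map.2 ⟨i, hi, rfl⟩
          rw [hτ'] at this
          obtain ⟨k, hk, he⟩ := List.mem_map.1 this
          exact ⟨k, Or.inr hk, he⟩
        have hcT : cs.wordProd τ ∈ StdParabolic cs T :=
          (hzc T (Set.image_mono hKT)).1 ((hzc0 T (Set.image_mono hKT)).2 hc0T)
        rintro _ ⟨k, hk | hk, rfl⟩
        · exact hKT hk
        · obtain ⟨l, hl, he⟩ := letters_of_mem cs T τ t2 hcT k hk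
          rw [← he]
          exact hl
  have hSK : S ⊆ K := by
    intro k hk
    rw [hKdef]
    exact ⟨S, stab, hk⟩
  exact parabolic_mono cs (Set.image_mono hSK) hcS
end

section
/- Let W be the Weyl group of type A_n (symmetric group S_{n+1}) with braid monoid B⁺ and canonical injection w ↦ \underline{w}, and let σ be the order-2 diagram automorphism (σ(s_i) = s_{n+1-i}). For any a ≤ (n+1)/2, writing u = s_{n+1-a} s_{n-a} ⋯ s_1, the following identity holds in B⁺: \underline{u} · σ(\underline{u}) · σ²(\underline{u}) ⋯ σ^{2a-2}(\underline{u}) · \underline{w_{K}} = \underline{w_I}, where K = {a+1, a+2, ..., n+1-a} and w_K, w_I are the longest elements of W_K and W. -/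
/-- The adjacent transposition `s_{i+1} = (i+1, i+2)` (0-based index `i`) in `S_{n+1}`. -/
def sA (n : ℕ) (i : Fin n) : Equiv.Perm (Fin (n + 1)) :=
  Equiv.swap i.castSucc i.succ

/-- The braid relations of type `A_n` on the free monoid on the generators. -/
def braidRelA (n : ℕ) : FreeMonoid (Fin n) → FreeMonoid (Fin n) → Prop := fun x y =>
  (∃ i j : Fin n, ((i : ℕ) + 1 = (j : ℕ) ∨ (j : ℕ) + 1 = (i : ℕ)) ∧
      x = FreeMonoid.of i * FreeMonoid.of j * FreeMonoid.of i ∧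
      y = FreeMonoid.of j * FreeMonoid.of i * FreeMonoid.of j) ∨
  (∃ i j : Fin n, ((i : ℕ) + 1 < (j : ℕ) ∨ (j : ℕ) + 1 < (i : ℕ)) ∧
      x = FreeMonoid.of i * FreeMonoid.of j ∧
      y = FreeMonoid.of j * FreeMonoid.of i)

/-- The length of a permutation with respect to the generators `sA n`. -/
noncomputable def lenA (n : ℕ) (g : Equiv.Perm (Fin (n + 1))) : ℕ :=
  sInf {m : ℕ | ∃ ω : List (Fin n), ω.length = m ∧ (ω.map (sA n)).prod = g}

/-- The descending word `[c-1, c-2, ..., 0]` (0-based), i.e. `s_c s_{c-1} ⋯ s_1`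
(1-based). -/
def descWordA (n c : ℕ) : List (Fin n) :=
  (List.range c).reverse.filterMap fun m => if h : m < n then some ⟨m, h⟩ else none

namespace BraidA

lemma sA_val (n : ℕ) (i : Fin n) (x : Fin (n + 1)) :
    ((sA n i x : Fin (n + 1)) : ℕ) =
      if (x : ℕ) = i then (i : ℕ) + 1 else if (x : ℕ) = i + 1 then (i : ℕ) else x := by
  unfold sA
  rw [Equiv.swap_apply_def]
  simp only [Fin.ext_iff, Fin.val_castSucc, Fin.val_succ]
  split_ifs <;> simp

lemma sA_mul_self (n : ℕ) (i : Fin n) : sA n i * sA n i = 1 := Equiv.swap_mul_self _ _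

lemma sA_sA (n : ℕ) (i : Fin n) (x : Fin (n + 1)) : sA n i (sA n i x) = x :=
  Equiv.swap_apply_self _ _ _

lemma sA_inv (n : ℕ) (i : Fin n) : (sA n i)⁻¹ = sA n i := Equiv.swap_inv _ _

/-- The inversions of `w⁻¹`. -/
def invs (n : ℕ) (w : Equiv.Perm (Fin (n + 1))) : Finset (Fin (n + 1) × Fin (n + 1)) :=
  Finset.univ.filter fun p => p.1 < p.2 ∧ w⁻¹ p.2 < w⁻¹ p.1

/-- The number of inversions. -/
def N (n : ℕ) (w : Equiv.Perm (Fin (n + 1))) : ℕ := (invs n w).card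

/-- Left descents. -/
def D (n : ℕ) (w : Equiv.Perm (Fin (n + 1))) (i : Fin n) : Prop :=
  w⁻¹ i.succ < w⁻¹ i.castSucc

lemma inv_smul (n : ℕ) (w : Equiv.Perm (Fin (n + 1))) (i : Fin n) (x : Fin (n + 1)) :
    (sA n i * w)⁻¹ x = w⁻¹ (sA n i x) := by
  rw [mul_inv_rev, sA_inv]; rfl

lemma sA_castSucc (n : ℕ) (i : Fin n) : sA n i i.castSucc = i.succ := Equiv.swap_apply_left _ _
lemma sA_succ (n : ℕ) (i : Fin n) : sA n i i.succ = i.castSucc := Equiv.swap_apply_right _ _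

lemma sA_lt (n : ℕ) (i : Fin n) (x y : Fin (n + 1)) (h : x < y)
    (hne : ¬ (x = i.castSucc ∧ y = i.succ)) : sA n i x < sA n i y := by
  rw [Fin.lt_def] at *
  rw [sA_val, sA_val]
  simp only [Fin.ext_iff, Fin.val_castSucc, Fin.val_succ] at hne
  split_ifs <;> omega

lemma N_desc (n : ℕ) (w : Equiv.Perm (Fin (n + 1))) (i : Fin n) (h : D n w i) :
    N n (sA n i * w) + 1 = N n w := by
  unfold D at h
  have hmem : (i.castSucc, i.succ) ∈ invs n w := by
    simpa [invs] using h
  unfold N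
  rw [← Finset.card_erase_add_one hmem]
  congr 1
  refine Finset.card_nbij' (fun p => (sA n i p.1, sA n i p.2))
    (fun p => (sA n i p.1, sA n i p.2)) ?_ ?_ ?_ ?_
  · rintro ⟨x, y⟩ hp
    simp only [invs, Finset.coe_filter, Finset.mem_univ, true_and, Set.mem_ofPred_eq,
      inv_smul] at hp
    have hne : ¬ (x = i.castSucc ∧ y = i.succ) := by
      rintro ⟨rfl, rfl⟩
      rw [sA_castSucc, sA_succ] at hp
      exact absurd hp.2 (not_lt.mpr h.le)
    have h1 := sA_lt n i x y hp.1 hne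
    simp only [invs, Finset.coe_erase, Finset.coe_filter, Finset.mem_univ, true_and,
      Set.mem_sdiff, Set.mem_ofPred_eq, Set.mem_singleton_iff, Prod.mk.injEq]
    refine ⟨⟨h1, hp.2⟩, ?_⟩
    rintro ⟨e1, e2⟩
    have e1' : x = i.succ := by rw [← sA_sA n i x, e1, sA_castSucc]
    have e2' : y = i.castSucc := by rw [← sA_sA n i y, e2, sA_succ]
    have := hp.1
    rw [e1', e2', Fin.lt_def] at this
    simp at this
  · rintro ⟨x, y⟩ hp
    simp only [invs, Finset.coe_erase, Finset.coe_filter, Finset.mem_univ, true_and,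
      Set.mem_sdiff, Set.mem_ofPred_eq, Set.mem_singleton_iff, Prod.mk.injEq] at hp
    simp only [invs, Finset.coe_filter, Finset.mem_univ, true_and, Set.mem_ofPred_eq,
      inv_smul, sA_sA]
    exact ⟨sA_lt n i x y hp.1.1 hp.2, hp.1.2⟩
  · rintro ⟨x, y⟩ _; simp [sA_sA]
  · rintro ⟨x, y⟩ _; simp [sA_sA]

lemma D_smul_self (n : ℕ) (w : Equiv.Perm (Fin (n + 1))) (i : Fin n) (h : ¬ D n w i) :
    D n (sA n i * w) i := by
  unfold D at *
  rw [inv_smul, inv_smul, sA_castSucc, sA_succ]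
  refine lt_of_le_of_ne (not_lt.mp h) ?_
  intro e
  have := w⁻¹.injective e
  rw [Fin.ext_iff] at this
  simp at this

lemma N_asc (n : ℕ) (w : Equiv.Perm (Fin (n + 1))) (i : Fin n) (h : ¬ D n w i) :
    N n (sA n i * w) = N n w + 1 := by
  have := N_desc n _ i (D_smul_self n w i h)
  rw [← mul_assoc, sA_mul_self, one_mul] at this
  exact this.symm

lemma N_one (n : ℕ) : N n 1 = 0 := by
  unfold N invs
  rw [Finset.card_eq_zero, Finset.filter_eq_empty_iff]
  rintro ⟨x, y⟩ _ ⟨h1, h2⟩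
  exact absurd h1 (not_lt.mpr (le_of_lt (by simpa using h2)))

/-- Product of a word. -/
def pr (n : ℕ) (ω : List (Fin n)) : Equiv.Perm (Fin (n + 1)) := (ω.map (sA n)).prod

lemma pr_nil (n : ℕ) : pr n [] = 1 := rfl
lemma pr_cons (n : ℕ) (i : Fin n) (ω : List (Fin n)) : pr n (i :: ω) = sA n i * pr n ω := by
  simp [pr]
lemma pr_append (n : ℕ) (ω ω' : List (Fin n)) : pr n (ω ++ ω') = pr n ω * pr n ω' := by
  simp [pr]

lemma N_pr_le (n : ℕ) (ω : List (Fin n)) : N n (pr n ω) ≤ ω.length := by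
  induction ω with
  | nil => rw [pr_nil, N_one]; simp
  | cons i t ih =>
    rw [pr_cons, List.length_cons]
    by_cases h : D n (pr n t) i
    · have := N_desc n _ i h; omega
    · have := N_asc n _ i h; omega

lemma eq_one_of_no_desc (n : ℕ) (w : Equiv.Perm (Fin (n + 1))) (h : ∀ i, ¬ D n w i) :
    w = 1 := by
  have hm : StrictMono (w⁻¹ : Equiv.Perm (Fin (n + 1))) := by
    rw [Fin.strictMono_iff_lt_succ]
    intro i
    have := D_smul_self n w i (h i)
    unfold D at this
    rwa [inv_smul, inv_smul, sA_castSucc, sA_succ] at this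
  have hmono : ∀ x, w⁻¹ x = x := by
    intro x
    have h2 := Subsingleton.elim
      (hm.orderIsoOfSurjective _ (w⁻¹ : Equiv.Perm (Fin (n + 1))).surjective) (OrderIso.refl _)
    exact congrArg (fun f => f x) h2
  have : w⁻¹ = 1 := Equiv.ext hmono
  exact inv_eq_one.mp this

lemma exists_word (n : ℕ) : ∀ (k : ℕ) (w : Equiv.Perm (Fin (n + 1))), N n w = k →
    ∃ ω : List (Fin n), ω.length = k ∧ pr n ω = w := by
  intro k
  induction k with
  | zero =>
    intro w hw
    refine ⟨[], rfl, ?_⟩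
    rw [pr_nil]
    symm
    apply eq_one_of_no_desc
    intro i hi
    have := N_desc n w i hi
    omega
  | succ k ih =>
    intro w hw
    by_cases h : ∃ i, D n w i
    · obtain ⟨i, hi⟩ := h
      have := N_desc n w i hi
      obtain ⟨ω, h1, h2⟩ := ih (sA n i * w) (by omega)
      refine ⟨i :: ω, by simp [h1], ?_⟩
      rw [pr_cons, h2, ← mul_assoc, sA_mul_self, one_mul]
    · push Not at h
      rw [eq_one_of_no_desc n w h, N_one] at hw
      omega

lemma lenA_eq (n : ℕ) (w : Equiv.Perm (Fin (n + 1))) : lenA n w = N n w := by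
  unfold lenA
  apply le_antisymm
  · obtain ⟨ω, h1, h2⟩ := exists_word n _ w rfl
    exact Nat.sInf_le ⟨ω, h1, h2⟩
  · have hne : {m : ℕ | ∃ ω : List (Fin n), ω.length = m ∧ (ω.map (sA n)).prod = w}.Nonempty := by
      obtain ⟨ω, h1, h2⟩ := exists_word n _ w rfl
      exact ⟨_, ω, h1, h2⟩
    obtain ⟨ω, h1, h2⟩ := Nat.sInf_mem hne
    rw [← h1, ← h2]
    exact N_pr_le n ω

/-- The class of a word in the braid monoid. -/
def bm (n : ℕ) (ω : List (Fin n)) : PresentedMonoid (braidRelA n) :=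
  PresentedMonoid.mk (braidRelA n) (FreeMonoid.ofList ω)

lemma bm_append (n : ℕ) (ω ω' : List (Fin n)) : bm n (ω ++ ω') = bm n ω * bm n ω' := by
  unfold bm
  rw [FreeMonoid.ofList_append, map_mul]

lemma bm_cons (n : ℕ) (i : Fin n) (ω : List (Fin n)) : bm n (i :: ω) = bm n [i] * bm n ω :=
  bm_append n [i] ω

lemma bm_rel (n : ℕ) (ω ω' : List (Fin n))
    (h : braidRelA n (FreeMonoid.ofList ω) (FreeMonoid.ofList ω')) : bm n ω = bm n ω' :=
  (Con.eq _).mpr (ConGen.Rel.of _ _ h)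

lemma bm_comm (n : ℕ) (i j : Fin n) (h : (i : ℕ) + 1 < j ∨ (j : ℕ) + 1 < i)
    (r : List (Fin n)) : bm n (i :: j :: r) = bm n (j :: i :: r) := by
  have : bm n [i, j] = bm n [j, i] := bm_rel n _ _ (Or.inr ⟨i, j, h, rfl, rfl⟩)
  exact (bm_append n [i, j] r).trans ((congrArg (· * bm n r) this).trans
    (bm_append n [j, i] r).symm)

lemma bm_braid (n : ℕ) (i j : Fin n) (h : (i : ℕ) + 1 = j ∨ (j : ℕ) + 1 = i)
    (r : List (Fin n)) : bm n (i :: j :: i :: r) = bm n (j :: i :: j :: r) := by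
  have : bm n [i, j, i] = bm n [j, i, j] := bm_rel n _ _ (Or.inl ⟨i, j, h, rfl, rfl⟩)
  exact (bm_append n [i, j, i] r).trans ((congrArg (· * bm n r) this).trans
    (bm_append n [j, i, j] r).symm)

lemma s_comm (n : ℕ) (i j : Fin n) (h : (i : ℕ) + 1 < j ∨ (j : ℕ) + 1 < i) :
    sA n i * sA n j = sA n j * sA n i := by
  ext x
  simp only [Equiv.Perm.mul_apply, sA_val]
  split_ifs <;> omega

lemma s_braid_aux (n : ℕ) (i j : Fin n) (h : (i : ℕ) + 1 = j) :
    sA n i * (sA n j * sA n i) = sA n j * (sA n i * sA n j) := by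
  have e : j.castSucc = i.succ := by ext; simp [h]
  have h1 : i.castSucc ≠ i.succ := by rw [Ne, Fin.ext_iff]; simp
  have h2 : i.castSucc ≠ j.succ := by rw [Ne, Fin.ext_iff]; simp; omega
  have h3 : j.succ ≠ i.succ := by rw [Ne, Fin.ext_iff]; simp; omega
  unfold sA
  rw [e, ← mul_assoc, ← mul_assoc, Equiv.swap_mul_swap_mul_swap h1 h2,
    Equiv.swap_comm i.castSucc i.succ, Equiv.swap_comm i.succ j.succ,
    Equiv.swap_mul_swap_mul_swap h3 h2.symm, Equiv.swap_comm]

lemma s_braid (n : ℕ) (i j : Fin n) (h : (i : ℕ) + 1 = j ∨ (j : ℕ) + 1 = i) :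
    sA n i * (sA n j * sA n i) = sA n j * (sA n i * sA n j) := by
  rcases h with h | h
  · exact s_braid_aux n i j h
  · exact (s_braid_aux n j i h).symm

lemma sA_fix (n : ℕ) (i : Fin n) (x : Fin (n + 1)) (h1 : (x : ℕ) ≠ i) (h2 : (x : ℕ) ≠ i + 1) :
    sA n i x = x := by
  rw [Fin.ext_iff, sA_val]; simp [h1, h2]

lemma D_comm (n : ℕ) (i j : Fin n) (h : (i : ℕ) + 1 < j ∨ (j : ℕ) + 1 < i)
    (w : Equiv.Perm (Fin (n + 1))) (hj : D n w j) : D n (sA n i * w) j := by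
  unfold D at *
  rw [inv_smul, inv_smul, sA_fix, sA_fix]
  · exact hj
  all_goals simp only [Fin.val_castSucc, Fin.val_succ]; omega

/-- For adjacent descents, the second step down. -/
lemma D_adj1 (n : ℕ) (i j : Fin n) (h : (i : ℕ) + 1 = j ∨ (j : ℕ) + 1 = i)
    (w : Equiv.Perm (Fin (n + 1))) (hi : D n w i) (hj : D n w j) : D n (sA n i * w) j := by
  unfold D at *
  rw [inv_smul, inv_smul]
  rcases h with h | h
  · have e1 : j.castSucc = i.succ := by ext; simp [h]
    rw [sA_fix n i j.succ (by simp; omega) (by simp; omega), e1, sA_succ]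
    rw [e1] at hj
    exact hj.trans hi
  · have e1 : i.castSucc = j.succ := by ext; simp [h]
    rw [sA_fix n i j.castSucc (by simp; omega) (by simp; omega), ← e1, sA_castSucc]
    rw [e1] at hi
    exact hi.trans hj

/-- For adjacent descents, the third step down. -/
lemma D_adj2 (n : ℕ) (i j : Fin n) (h : (i : ℕ) + 1 = j ∨ (j : ℕ) + 1 = i)
    (w : Equiv.Perm (Fin (n + 1))) (hj : D n w j) :
    D n (sA n j * (sA n i * w)) i := by
  unfold D at *
  rw [inv_smul, inv_smul, inv_smul, inv_smul]
  rcases h with h | h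
  · have e1 : j.castSucc = i.succ := by ext; simp [h]
    rw [sA_fix n j i.castSucc (by simp; omega) (by simp; omega), sA_castSucc, ← e1, sA_castSucc,
      sA_fix n i j.succ (by simp; omega) (by simp; omega)]
    exact hj
  · have e1 : i.castSucc = j.succ := by ext; simp [h]
    rw [sA_fix n j i.succ (by simp; omega) (by simp; omega), sA_succ, e1, sA_succ,
      sA_fix n i j.castSucc (by simp; omega) (by simp; omega)]
    exact hj

/-- Matsumoto's theorem in type `A`. -/
theorem matsumoto (n : ℕ) : ∀ (k : ℕ) (ω ω' : List (Fin n)), ω.length = k → ω'.length = k →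
    pr n ω = pr n ω' → N n (pr n ω) = k → bm n ω = bm n ω' := by
  intro k
  induction k with
  | zero =>
    intro ω ω' h1 h2 _ _
    rw [List.length_eq_zero_iff.mp h1, List.length_eq_zero_iff.mp h2]
  | succ k ih =>
    intro ω ω' h1 h2 hp hN
    obtain ⟨i, t, rfl⟩ := List.exists_cons_of_length_eq_add_one h1
    obtain ⟨j, t', rfl⟩ := List.exists_cons_of_length_eq_add_one h2
    rw [List.length_cons, Nat.add_right_cancel_iff] at h1 h2
    have key : ∀ (i : Fin n) (t : List (Fin n)), t.length = k → N n (pr n (i :: t)) = k + 1 →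
        D n (pr n (i :: t)) i ∧ pr n t = sA n i * pr n (i :: t) ∧ N n (pr n t) = k := by
      intro i t ht hN
      have hle := N_pr_le n t
      have e : pr n t = sA n i * pr n (i :: t) := by
        rw [pr_cons, ← mul_assoc, sA_mul_self, one_mul]
      have hD : D n (pr n (i :: t)) i := by
        by_contra hc
        have := N_asc n _ i hc
        rw [← e] at this
        omega
      refine ⟨hD, e, ?_⟩
      have := N_desc n _ i hD
      rw [← e] at this
      omega
    obtain ⟨Di, ei, Ni⟩ := key i t h1 hN
    obtain ⟨Dj, ej, Nj⟩ := key j t' h2 (hp ▸ hN)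
    rw [← hp] at Dj ej
    generalize pr n (i :: t) = w at *
    rw [bm_cons n i t, bm_cons n j t']
    have hcases : i = j ∨ ((i : ℕ) + 1 < j ∨ (j : ℕ) + 1 < i) ∨
        ((i : ℕ) + 1 = j ∨ (j : ℕ) + 1 = i) := by
      rw [Fin.ext_iff]; omega
    have back : ∀ (i : Fin n) (v : Equiv.Perm (Fin (n + 1))), sA n i * (sA n i * v) = v := by
      intro i v
      rw [← mul_assoc, sA_mul_self, one_mul]
    rcases hcases with heq | hfar | hadj
    · subst heq
      rw [ih t t' h1 h2 (ei.trans ej.symm) Ni]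
    · have n2 := N_desc n _ j (D_comm n i j hfar w Dj)
      rw [← ei] at n2
      obtain ⟨r, hr, hpr⟩ := exists_word n _ (sA n j * pr n t) rfl
      have a1 : bm n t = bm n (j :: r) := by
        apply ih t (j :: r) h1 (by simp; omega) _ Ni
        rw [pr_cons, hpr, back]
      have a2 : bm n t' = bm n (i :: r) := by
        apply ih t' (i :: r) h2 (by simp; omega) _ Nj
        rw [pr_cons, hpr, ei, ej, ← mul_assoc (sA n j), ← s_comm n i j hfar, mul_assoc, back]
      rw [a1, a2, ← bm_cons, ← bm_cons, bm_comm n i j hfar]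
    · have n2 := N_desc n _ j (D_adj1 n i j hadj w Di Dj)
      have n3 := N_desc n _ i (D_adj2 n i j hadj w Dj)
      rw [← ei] at n2 n3
      obtain ⟨r, hr, hpr⟩ := exists_word n _ (sA n i * (sA n j * pr n t)) rfl
      have a1 : bm n t = bm n (j :: i :: r) := by
        apply ih t (j :: i :: r) h1 (by simp; omega) _ Ni
        rw [pr_cons, pr_cons, hpr, back, back]
      have a2 : bm n t' = bm n (i :: j :: r) := by
        apply ih t' (i :: j :: r) h2 (by simp; omega) _ Nj
        have e3 : sA n i * (sA n j * (sA n i * w)) = sA n j * (sA n i * (sA n j * w)) := by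
          have := congrArg (· * w) (s_braid n i j hadj)
          simpa only [mul_assoc] using this
        rw [pr_cons, pr_cons, hpr, ei, ej, e3, back, back]
      rw [a1, a2, ← bm_cons, ← bm_cons, bm_braid n i j hadj]

/-- The word for the product of the twists of `u`. -/
def U (n a : ℕ) : List (Fin n) :=
  ((List.range (2 * a - 1)).map fun k =>
    (descWordA n (n + 1 - a)).map ((fun i : Fin n => i.rev)^[k])).flatten

lemma perm_val_inv {n : ℕ} (w : Equiv.Perm (Fin (n + 1))) (x : Fin (n + 1)) :
    w (w⁻¹ x) = x := by simp

lemma inv_perm_val {n : ℕ} (w : Equiv.Perm (Fin (n + 1))) (x : Fin (n + 1)) :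
    w⁻¹ (w x) = x := by simp

lemma wI_val (n : ℕ) (w : Equiv.Perm (Fin (n + 1))) (h : ∀ g, N n g ≤ N n w) :
    w = Fin.revPerm := by
  have hD : ∀ i, D n w i := by
    intro i
    by_contra hc
    have e := N_asc n w i hc
    have := h (sA n i * w)
    omega
  have : w * Fin.revPerm = 1 := by
    rw [← inv_eq_one]
    have hm : StrictMono ((w * Fin.revPerm)⁻¹ : Equiv.Perm (Fin (n + 1))) := by
      rw [Fin.strictMono_iff_lt_succ]
      intro i
      change Fin.rev (w⁻¹ i.castSucc) < Fin.rev (w⁻¹ i.succ)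
      rw [Fin.rev_lt_rev]
      exact hD i
    ext1 x
    have h2 := Subsingleton.elim
      (hm.orderIsoOfSurjective _ (Equiv.surjective _)) (OrderIso.refl _)
    exact congrArg (fun f => f x) h2
  ext1 x
  have h3 := congrArg (fun f => f (Fin.rev x)) this
  simpa using h3

lemma wK_fix (n a : ℕ) (w : Equiv.Perm (Fin (n + 1)))
    (h : w ∈ Subgroup.closure (sA n '' {i : Fin n | a ≤ (i : ℕ) ∧ (i : ℕ) + a ≤ n}))
    (x : Fin (n + 1)) (hx : (x : ℕ) < a ∨ n + 1 < (x : ℕ) + a) : w x = x := by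
  induction h using Subgroup.closure_induction with
  | mem g hg =>
    obtain ⟨i, ⟨h1, h2⟩, rfl⟩ := hg
    exact sA_fix n i x (by omega) (by omega)
  | one => rfl
  | mul g g' _ _ e1 e2 => rw [Equiv.Perm.mul_apply, e2, e1]
  | inv g _ e =>
    rw [Equiv.Perm.inv_eq_iff_eq]; exact e.symm

lemma wK_inv_val (n a : ℕ) (ha1 : 1 ≤ a) (ha : 2 * a ≤ n + 1) (w : Equiv.Perm (Fin (n + 1)))
    (hfix : ∀ x : Fin (n + 1), ((x : ℕ) < a ∨ n + 1 < (x : ℕ) + a) → w x = x)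
    (hD : ∀ i : Fin n, a ≤ (i : ℕ) → (i : ℕ) + a ≤ n → D n w i)
    (x : Fin (n + 1)) (h1 : a ≤ (x : ℕ)) (h2 : (x : ℕ) + a ≤ n + 1) :
    ((w⁻¹ x : Fin (n + 1)) : ℕ) = n + 1 - x := by
  have hin : ∀ x : Fin (n + 1), a ≤ (x : ℕ) → (x : ℕ) + a ≤ n + 1 →
      a ≤ ((w⁻¹ x : Fin (n + 1)) : ℕ) ∧ ((w⁻¹ x : Fin (n + 1)) : ℕ) + a ≤ n + 1 := by
    intro x h1 h2
    by_contra hc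
    have e := hfix (w⁻¹ x) (by omega)
    rw [perm_val_inv] at e
    rw [← e] at hc
    omega
  have hstep : ∀ k (h : k + 1 < n + 1), a ≤ k → k + a ≤ n →
      ((w⁻¹ ⟨k + 1, h⟩ : Fin (n + 1)) : ℕ) < ((w⁻¹ ⟨k, by omega⟩ : Fin (n + 1)) : ℕ) := by
    intro k h h1 h2
    exact hD ⟨k, by omega⟩ h1 h2
  have up : ∀ j (h : a + j < n + 1), 2 * a + j ≤ n + 1 →
      ((w⁻¹ ⟨a + j, h⟩ : Fin (n + 1)) : ℕ) + a + j ≤ n + 1 := by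
    intro j
    induction j with
    | zero => intro h hh; exact (hin ⟨a, h⟩ le_rfl (by simp; omega)).2
    | succ j ih =>
      intro h hh
      have := ih (by omega) (by omega)
      have := hstep (a + j) h (by omega) (by omega)
      simp only [← add_assoc] at *
      omega
  have lo : ∀ j k (h : k < n + 1), k + a + j = n + 1 → a ≤ k →
      a + j ≤ ((w⁻¹ ⟨k, h⟩ : Fin (n + 1)) : ℕ) := by
    intro j
    induction j with
    | zero => intro k h hk hh; exact (hin ⟨k, h⟩ hh (by simp; omega)).1
    | succ j ih =>
      intro k h hk hh
      by_cases hkn : k + 1 < n + 1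
      · have := ih (k + 1) hkn (by omega) (by omega)
        have := hstep k hkn (by omega) (by omega)
        omega
      · have := (hin ⟨k, h⟩ hh (by simp; omega)).1
        omega
  have u1 := up (x - a) (by omega) (by omega)
  have e : (⟨a + (x - a), by omega⟩ : Fin (n + 1)) = x := by ext; simp; omega
  rw [e] at u1
  have l1 := lo (n + 1 - a - x) x x.2 (by omega) h1
  simp only [Fin.eta] at l1
  omega

lemma wK_val (n a : ℕ) (w : Equiv.Perm (Fin (n + 1)))
    (hfix : ∀ x : Fin (n + 1), ((x : ℕ) < a ∨ n + 1 < (x : ℕ) + a) → w x = x)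
    (hq : ∀ x : Fin (n + 1), a ≤ (x : ℕ) → (x : ℕ) + a ≤ n + 1 →
      ((w⁻¹ x : Fin (n + 1)) : ℕ) = n + 1 - x)
    (x : Fin (n + 1)) (h1 : a ≤ (x : ℕ)) (h2 : (x : ℕ) + a ≤ n + 1) :
    ((w x : Fin (n + 1)) : ℕ) = n + 1 - x := by
  have hin : a ≤ ((w x : Fin (n + 1)) : ℕ) ∧ ((w x : Fin (n + 1)) : ℕ) + a ≤ n + 1 := by
    by_contra hc
    have e := hfix (w x) (by omega)
    have e' := w.injective e
    rw [e'] at hc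
    omega
  have := hq (w x) hin.1 hin.2
  rw [inv_perm_val] at this
  omega

lemma card_pairs {m : ℕ} (s : Finset (Fin m)) :
    2 * (s.offDiag.filter fun p => p.1 < p.2).card = s.card * s.card - s.card := by
  rw [← Finset.offDiag_card, two_mul,
    ← Finset.card_filter_add_card_filter_not (s := s.offDiag) (fun p => p.1 < p.2)]
  congr 1
  refine Finset.card_nbij' Prod.swap Prod.swap ?_ ?_ ?_ ?_
  · rintro ⟨x, y⟩ h
    simp only [Finset.coe_filter, Finset.mem_offDiag, Set.mem_ofPred_eq, Prod.swap] at h ⊢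
    exact ⟨⟨h.1.2.1, h.1.1, h.1.2.2.symm⟩, not_lt.mpr h.2.le⟩
  · rintro ⟨x, y⟩ h
    simp only [Finset.coe_filter, Finset.mem_offDiag, Set.mem_ofPred_eq, Prod.swap] at h ⊢
    exact ⟨⟨h.1.2.1, h.1.1, h.1.2.2.symm⟩, lt_of_le_of_ne (not_lt.mp h.2) h.1.2.2.symm⟩
  · intro _ _; simp
  · intro _ _; simp

lemma N_bound (n a : ℕ) (ha1 : 1 ≤ a) (ha : 2 * a ≤ n + 1) (w w' : Equiv.Perm (Fin (n + 1)))
    (hw' : w' = Fin.revPerm)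
    (hfix : ∀ x : Fin (n + 1), ((x : ℕ) < a ∨ n + 1 < (x : ℕ) + a) → w x = x)
    (hq : ∀ x : Fin (n + 1), a ≤ (x : ℕ) → (x : ℕ) + a ≤ n + 1 →
      ((w⁻¹ x : Fin (n + 1)) : ℕ) = n + 1 - x) :
    (2 * a - 1) * (n + 1 - a) + N n w ≤ N n w' := by
  have h1 : N n w' = ((Finset.univ : Finset (Fin (n + 1))).offDiag.filter
      fun p => p.1 < p.2).card := by
    unfold N invs
    congr 1
    ext ⟨x, y⟩
    subst hw'
    simp only [Finset.mem_filter, Finset.mem_univ, true_and, Finset.mem_offDiag]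
    constructor
    · rintro ⟨h, _⟩; exact ⟨h.ne, h⟩
    · rintro ⟨_, h⟩
      refine ⟨h, ?_⟩
      change Fin.rev y < Fin.rev x
      rwa [Fin.rev_lt_rev]
  have h2 := card_pairs (Finset.univ : Finset (Fin (n + 1)))
  rw [← h1, Finset.card_univ, Fintype.card_fin] at h2
  have hq' : ∀ x : Fin (n + 1), ((x : ℕ) < a ∨ n + 1 < (x : ℕ) + a) →
      w⁻¹ x = x := by
    intro x hx
    rw [Equiv.Perm.inv_eq_iff_eq]; exact (hfix x hx).symm
  let s : Finset (Fin (n + 1)) := Finset.Icc ⟨a, by omega⟩ ⟨n + 1 - a, by omega⟩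
  have hs : s.card = n + 2 - 2 * a := by
    simp only [s, Fin.card_Icc]; omega
  have h3 : N n w ≤ (s.offDiag.filter fun p => p.1 < p.2).card := by
    unfold N
    apply Finset.card_le_card
    rintro ⟨x, y⟩ h
    simp only [invs, Finset.mem_filter, Finset.mem_univ, true_and] at h
    simp only [s, Finset.mem_filter, Finset.mem_offDiag, Finset.mem_Icc, Fin.le_def]
    obtain ⟨hxy, hyx⟩ := h
    refine ⟨?_, hxy⟩
    have hne : x ≠ y := hxy.ne
    rw [Fin.lt_def] at hxy hyx
    by_cases hx : (x : ℕ) < a ∨ n + 1 < (x : ℕ) + a <;>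
    by_cases hy : (y : ℕ) < a ∨ n + 1 < (y : ℕ) + a
    · rw [hq' x hx, hq' y hy] at hyx; omega
    · rw [hq' x hx, hq y (by omega) (by omega)] at hyx; omega
    · rw [hq' y hy, hq x (by omega) (by omega)] at hyx; omega
    · refine ⟨?_, ?_, hne⟩ <;> omega
  have h4 := card_pairs s
  rw [hs] at h4
  obtain ⟨d, hd⟩ := Nat.exists_eq_add_of_le ha
  obtain ⟨b, rfl⟩ := Nat.exists_eq_add_of_le ha1
  have e1 : n + 2 - 2 * (1 + b) = d + 1 := by omega
  have e2 : n + 1 - (1 + b) = 1 + b + d := by omega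
  have e3 : 2 * (1 + b) - 1 = 2 * b + 1 := by omega
  rw [e1] at h4
  rw [hd] at h2
  rw [e2, e3]
  have h4' : (d + 1) * (d + 1) - (d + 1) = d * (d + 1) := by
    rw [Nat.sub_eq_iff_eq_add (by nlinarith)]; ring
  have h2' : (2 * (1 + b) + d) * (2 * (1 + b) + d) - (2 * (1 + b) + d)
      = (2 * (1 + b) + d) * (2 * b + 1 + d) := by
    rw [Nat.sub_eq_iff_eq_add (by nlinarith)]; ring
  rw [h4'] at h4
  rw [h2'] at h2
  nlinarith

lemma descWord_succ (n c : ℕ) (h : c < n) :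
    descWordA n (c + 1) = ⟨c, h⟩ :: descWordA n c := by
  unfold descWordA
  rw [List.range_succ, List.reverse_append]
  simp [h]

lemma descWord_length (n c : ℕ) (h : c ≤ n) : (descWordA n c).length = c := by
  induction c with
  | zero => rfl
  | succ c ih => rw [descWord_succ n c h, List.length_cons, ih (by omega)]

lemma length_U (n a : ℕ) (ha1 : 1 ≤ a) : (U n a).length = (2 * a - 1) * (n + 1 - a) := by
  unfold U
  rw [List.length_flatten, List.map_map]
  have : (List.length ∘ fun k => (descWordA n (n + 1 - a)).map ((fun i : Fin n => i.rev)^[k]))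
      = fun _ => n + 1 - a := by
    funext k
    simp only [Function.comp, List.length_map]
    exact descWord_length n _ (by omega)
  rw [this]
  simp

lemma u_val (n c : ℕ) (h : c ≤ n) (x : Fin (n + 1)) :
    ((pr n (descWordA n c) x : Fin (n + 1)) : ℕ) =
      if (x : ℕ) = 0 then c else if (x : ℕ) ≤ c then x - 1 else x := by
  induction c with
  | zero =>
    change (x : ℕ) = _
    split_ifs <;> omega
  | succ c ih =>
    rw [descWord_succ n c h, pr_cons, Equiv.Perm.mul_apply, sA_val, ih (by omega)]
    simp only
    split_ifs <;> omega

lemma su_val (n c : ℕ) (h : c ≤ n) (x : Fin (n + 1)) :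
    ((pr n ((descWordA n c).map fun i => i.rev) x : Fin (n + 1)) : ℕ) =
      if (x : ℕ) = n then n - c else if n - c ≤ (x : ℕ) then x + 1 else x := by
  induction c with
  | zero =>
    change (x : ℕ) = _
    split_ifs <;> omega
  | succ c ih =>
    rw [descWord_succ n c h, List.map_cons, pr_cons, Equiv.Perm.mul_apply, sA_val, ih (by omega)]
    simp only [Fin.val_rev]
    split_ifs <;> omega

lemma rev_iter_even {n : ℕ} (b : ℕ) : (fun i : Fin n => i.rev)^[2 * b] = id := by
  rw [Function.iterate_mul]
  have : (fun i : Fin n => i.rev)^[2] = id := by funext i; simp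
  rw [this, Function.iterate_id]

lemma rev_iter_odd {n : ℕ} (b : ℕ) :
    (fun i : Fin n => i.rev)^[2 * b + 1] = fun i : Fin n => i.rev := by
  rw [Function.iterate_succ, rev_iter_even]; rfl

lemma pr_twists (n : ℕ) (l : List (Fin n)) (b : ℕ) :
    pr n ((List.range (2 * b + 1)).map fun k => l.map ((fun i : Fin n => i.rev)^[k])).flatten =
      (pr n l * pr n (l.map fun i => i.rev)) ^ b * pr n l := by
  induction b with
  | zero => simp
  | succ b ih =>
    rw [show 2 * (b + 1) + 1 = 2 * b + 1 + 1 + 1 by ring, List.range_succ, List.range_succ]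
    simp only [List.map_append, List.flatten_append, pr_append, ih]
    rw [show 2 * b + 1 + 1 = 2 * (b + 1) by ring]
    simp only [List.map_cons, List.map_nil, List.flatten_cons, List.flatten_nil,
      List.append_nil, rev_iter_even, rev_iter_odd, List.map_id]
    rw [pow_succ]
    simp only [mul_assoc]

/-- The order in which `u σ(u)` cycles through the points. -/
def pos (n b p : ℕ) : ℕ := if p ≤ b then n - b + p else 2 * b - p

lemma prod_eq (n a : ℕ) (ha1 : 1 ≤ a) (ha : 2 * a ≤ n + 1) (w w' : Equiv.Perm (Fin (n + 1)))
    (hw' : w' = Fin.revPerm)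
    (hfix : ∀ x : Fin (n + 1), ((x : ℕ) < a ∨ n + 1 < (x : ℕ) + a) → w x = x)
    (hw : ∀ x : Fin (n + 1), a ≤ (x : ℕ) → (x : ℕ) + a ≤ n + 1 →
      ((w x : Fin (n + 1)) : ℕ) = n + 1 - x) :
    pr n (U n a) * w = w' := by
  obtain ⟨b, rfl⟩ := Nat.exists_eq_add_of_le' ha1
  subst hw'
  unfold U
  rw [show 2 * (b + 1) - 1 = 2 * b + 1 by omega, pr_twists,
    show n + 1 - (b + 1) = n - b by omega]
  have hu := u_val n (n - b) (by omega)
  have hsu := su_val n (n - b) (by omega)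
  generalize pr n (descWordA n (n - b)) = u at *
  generalize pr n ((descWordA n (n - b)).map fun i => i.rev) = v at *
  have hmid : ∀ k (x : Fin (n + 1)), b ≤ (x : ℕ) → (x : ℕ) + b < n →
      ((((u * v) ^ k) x : Fin (n + 1)) : ℕ) = x := by
    intro k x h1 h2
    induction k with
    | zero => rfl
    | succ k ih =>
      rw [pow_succ', Equiv.Perm.mul_apply, Equiv.Perm.mul_apply, hu, hsu, ih]
      split_ifs <;> first | omega | contradiction
  have hcyc : ∀ k p (x : Fin (n + 1)), k ≤ b → p ≤ 2 * b → (x : ℕ) = pos n b p →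
      ((((u * v) ^ k) x : Fin (n + 1)) : ℕ) =
        pos n b (if p + k ≤ 2 * b then p + k else p + k - (2 * b + 1)) := by
    intro k p x hk hp hx
    induction k with
    | zero => simp [hx, hp]
    | succ k ih =>
      rw [pow_succ', Equiv.Perm.mul_apply, Equiv.Perm.mul_apply, hu, hsu, ih (by omega)]
      unfold pos
      clear hu hsu hw hfix ih hmid hx
      split_ifs <;> first | omega | contradiction
  ext x
  rw [Equiv.Perm.mul_apply, Equiv.Perm.mul_apply]
  simp only [Fin.revPerm_apply, Fin.val_rev]
  by_cases h1 : (x : ℕ) < b + 1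
  · have e := hu (w x)
    rw [hfix x (by omega)] at e ⊢
    by_cases h0 : (x : ℕ) = 0
    · rw [hcyc b 0 _ le_rfl (by omega) (by rw [e]; unfold pos; split_ifs <;> omega)]
      unfold pos; split_ifs <;> omega
    · rw [hcyc b (2 * b + 1 - x) _ le_rfl (by omega) (by rw [e]; unfold pos; split_ifs <;> omega)]
      unfold pos; split_ifs <;> omega
  · by_cases h2 : n + 1 < (x : ℕ) + (b + 1)
    · have e := hu (w x)
      rw [hfix x (by omega)] at e ⊢
      rw [hcyc b (x - (n - b)) _ le_rfl (by omega) (by rw [e]; unfold pos; split_ifs <;> omega)]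
      unfold pos; split_ifs <;> omega
    · have e := hu (w x)
      rw [hw x (by omega) (by omega)] at e
      have e' : ((u (w x) : Fin (n + 1)) : ℕ) = n - x := by
        rw [e]; split_ifs <;> omega
      rw [hmid b _ (by omega) (by omega), e']
      omega

end BraidA

/-- Lemma 7.24(1): in the braid monoid `B⁺` of type `A_n`, with `σ` the order-2 diagram
automorphism and `u = s_{n+1-a} ⋯ s_1`, one has
`u·σ(u)⋯σ^{2a-2}(u)·w_K = w_I`, where `K = {a+1, ..., n+1-a}` (1-based). Here the images
`\underline{w}` of Weyl group elements in `B⁺` are represented by reduced words. -/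
theorem braid_identity_typeA (n a : ℕ) (ha1 : 1 ≤ a) (ha : a ≤ (n + 1) / 2)
    (wK wI : Equiv.Perm (Fin (n + 1)))
    (hwKmem : wK ∈ Subgroup.closure
      (sA n '' {i : Fin n | a ≤ (i : ℕ) ∧ (i : ℕ) + a ≤ n}))
    (hwKmax : ∀ h ∈ Subgroup.closure
      (sA n '' {i : Fin n | a ≤ (i : ℕ) ∧ (i : ℕ) + a ≤ n}), lenA n h ≤ lenA n wK)
    (hwImax : ∀ h : Equiv.Perm (Fin (n + 1)), lenA n h ≤ lenA n wI)
    (ωK ωI : List (Fin n))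
    (hωKred : (ωK.map (sA n)).prod = wK ∧ ωK.length = lenA n wK)
    (hωIred : (ωI.map (sA n)).prod = wI ∧ ωI.length = lenA n wI) :
    PresentedMonoid.mk (braidRelA n)
        (FreeMonoid.ofList
          ((((List.range (2 * a - 1)).map fun k =>
              (descWordA n (n + 1 - a)).map ((fun i : Fin n => i.rev)^[k]))).flatten ++ ωK))
      = PresentedMonoid.mk (braidRelA n) (FreeMonoid.ofList ωI) := by
  obtain ⟨hK1, hK2⟩ := hωKred
  obtain ⟨hI1, hI2⟩ := hωIred
  simp only [BraidA.lenA_eq] at *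
  have hwI := BraidA.wI_val n wI hwImax
  have hfix := BraidA.wK_fix n a wK hwKmem
  have hdesc : ∀ i : Fin n, a ≤ (i : ℕ) → (i : ℕ) + a ≤ n → BraidA.D n wK i := by
    intro i h1 h2
    by_contra hc
    have e := BraidA.N_asc n wK i hc
    have := hwKmax (sA n i * wK)
      (Subgroup.mul_mem _ (Subgroup.subset_closure ⟨i, ⟨h1, h2⟩, rfl⟩) hwKmem)
    omega
  have hq := BraidA.wK_inv_val n a ha1 (by omega) wK hfix hdesc
  have hwK := BraidA.wK_val n a wK hfix hq
  have hcard := BraidA.N_bound n a ha1 (by omega) wK wI hwI hfix hq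
  have hprod := BraidA.prod_eq n a ha1 (by omega) wK wI hwI hfix hwK
  have hlen := BraidA.length_U n a ha1
  refine BraidA.matsumoto n (BraidA.N n wI) _ _ ?_ hI2 ?_ ?_
  · have h1 := BraidA.N_pr_le n (BraidA.U n a ++ ωK)
    rw [BraidA.pr_append, show BraidA.pr n ωK = wK from hK1, hprod] at h1
    change (BraidA.U n a ++ ωK).length = _
    rw [List.length_append, hlen, hK2] at h1 ⊢
    omega
  · change BraidA.pr n (BraidA.U n a ++ ωK) = BraidA.pr n ωI
    rw [BraidA.pr_append, show BraidA.pr n ωK = wK from hK1, hprod]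
    exact hI1.symm
  · change BraidA.N n (BraidA.pr n (BraidA.U n a ++ ωK)) = _
    rw [BraidA.pr_append, show BraidA.pr n ωK = wK from hK1, hprod]
end
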